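/- arXiv:2111.14410 — 2 statements merged into one kernel-verified Lean document; each statement's English description precedes it below -/
import Mathlib

section
/- Let n ∈ {4, 5} and let h ∈ ℂ[X₀,…,Xₙ] be an irreducible homogeneous polynomial of degree n − 1 defining a totally invariant hypersurface X = {h = 0} ⊂ ℙⁿ(ℂ). Then the singular locus of X has dimension n − 2 or n − 3; in particular the Jacobian ring J(h) has Krull dimension ≥ n − 2. -/
open MvPolynomial

/-- `F` is an endomorphism of `ℙ^{N-1}(ℂ)` of algebraic degree `q`: a tuple of `N`
homogeneous polynomials of degree `q` in `N` variables whose only common zero in `ℂ^N`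
is the origin. -/
def IsEndo (N q : ℕ) (F : Fin N → MvPolynomial (Fin N) ℂ) : Prop :=
  (∀ i, (F i).IsHomogeneous q) ∧
    ∀ x : Fin N → ℂ, (∀ i, eval x (F i) = 0) → x = 0

/-- The hypersurface `{h = 0} ⊂ ℙ^{N-1}(ℂ)` is totally invariant: there is a non-trivial
endomorphism `F` (of algebraic degree `q ≥ 2`) and `λ ≠ 0` with `h(F₀,…,F_{N-1}) = λ·h^q`. -/
def IsTotallyInvariant (N : ℕ) (h : MvPolynomial (Fin N) ℂ) : Prop :=
  ∃ q, 2 ≤ q ∧ ∃ F : Fin N → MvPolynomial (Fin N) ℂ, IsEndo N q F ∧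
    ∃ lam : ℂ, lam ≠ 0 ∧ aeval F h = C lam * h ^ q

/-- The Jacobian ideal `(h, ∂h/∂X₀, …, ∂h/∂X_{N-1})`. -/
noncomputable def jacobianIdeal (N : ℕ) (h : MvPolynomial (Fin N) ℂ) : Ideal (MvPolynomial (Fin N) ℂ) :=
  Ideal.span (insert h (Set.range fun i => pderiv i h))

namespace TI

section Koszul
variable {N : ℕ} {ι : Type*} [DecidableEq ι]

theorem hc_mul (e D : ℕ) (c f : MvPolynomial (Fin N) ℂ) (hf : f.IsHomogeneous e) :
    homogeneousComponent D (c * f) = (if e ≤ D then homogeneousComponent (D - e) c else 0) * f := by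
  classical
  conv_lhs => rw [← sum_homogeneousComponent c, Finset.sum_mul, map_sum]
  have h1 : ∀ k, homogeneousComponent D (homogeneousComponent k c * f) =
      if k + e = D then homogeneousComponent k c * f else 0 := by
    intro k
    have hm : homogeneousComponent k c * f ∈ homogeneousSubmodule (Fin N) ℂ (k + e) :=
      (homogeneousComponent_isHomogeneous k c).mul hf
    rw [homogeneousComponent_of_mem hm]
    by_cases h : D = k + e
    · simp [h]
    · simp [h, Ne.symm h]
  simp_rw [h1]
  split_ifs with hle
  · rw [Finset.sum_eq_single (D - e)]
    · rw [if_pos (by omega)]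
    · intro b _ hb; rw [if_neg (by omega)]
    · intro hb
      rw [Finset.mem_range, not_lt] at hb
      rw [homogeneousComponent_eq_zero _ _ (by omega)]; simp
  · rw [zero_mul]
    apply Finset.sum_eq_zero
    intro k _; rw [if_neg (by omega)]

/-- shifted homogeneous component -/
noncomputable def T (e D : ℕ) (c : MvPolynomial (Fin N) ℂ) : MvPolynomial (Fin N) ℂ :=
  if e ≤ D then homogeneousComponent (D - e) c else 0

theorem T_mul (e e' D : ℕ) (c f : MvPolynomial (Fin N) ℂ) (hf : f.IsHomogeneous e') :
    T e D (c * f) = T (e + e') D c * f := by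
  unfold T
  by_cases h : e ≤ D
  · rw [if_pos h, hc_mul _ _ _ _ hf]
    by_cases h' : e' ≤ D - e
    · rw [if_pos h', if_pos (by omega), Nat.sub_sub]
    · rw [if_neg h', if_neg (by omega)]
  · rw [if_neg h, if_neg (by omega), zero_mul]

theorem T_zero (D : ℕ) (c : MvPolynomial (Fin N) ℂ) : T 0 D c = homogeneousComponent D c := by
  simp [T]

theorem T_sum {κ : Type*} (s : Finset κ) (e D : ℕ) (c : κ → MvPolynomial (Fin N) ℂ) :
    T e D (∑ k ∈ s, c k) = ∑ k ∈ s, T e D (c k) := by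
  unfold T; split_ifs <;> simp

theorem T_neg (e D : ℕ) (c : MvPolynomial (Fin N) ℂ) : T e D (-c) = - T e D c := by
  unfold T; split_ifs <;> simp

theorem T_hom (e D : ℕ) (c : MvPolynomial (Fin N) ℂ) : (T e D c).IsHomogeneous (D - e) := by
  unfold T; split_ifs
  · exact homogeneousComponent_isHomogeneous _ _
  · exact isHomogeneous_zero _ _ _

theorem T_self (e D : ℕ) (c : MvPolynomial (Fin N) ℂ) (h : e ≤ D) (hc : c.IsHomogeneous (D - e)) :
    T e D c = c := by
  unfold T; rw [if_pos h]; exact homogeneousComponent_eq_self hc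

theorem T_total (e M : ℕ) (c : MvPolynomial (Fin N) ℂ) (hM : e + c.totalDegree < M) :
    ∑ D ∈ Finset.range M, T e D c = c := by
  obtain ⟨K, rfl⟩ : ∃ K, M = e + K := ⟨M - e, by omega⟩
  rw [Finset.sum_range_add]
  have h1 : ∑ D ∈ Finset.range e, T e D c = 0 := by
    apply Finset.sum_eq_zero
    intro D hD; rw [Finset.mem_range] at hD; unfold T; rw [if_neg (by omega)]
  rw [h1, zero_add]
  have h2 : ∀ k, T e (e + k) c = homogeneousComponent k c := by
    intro k; unfold T; rw [if_pos (by omega)]; congr 2; omega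
  simp_rw [h2]
  conv_rhs => rw [← sum_homogeneousComponent c]
  symm
  apply Finset.sum_subset
  · intro x hx; simp only [Finset.mem_range] at *; omega
  · intro x _ hx
    simp only [Finset.mem_range] at hx
    exact homogeneousComponent_eq_zero _ _ (by omega)

/-- vanishing of first Koszul homology of the family `f` on `s` -/
def H1 (s : Finset ι) (f : ι → MvPolynomial (Fin N) ℂ) : Prop :=
  ∀ a : ι → MvPolynomial (Fin N) ℂ, ∑ i ∈ s, a i * f i = 0 →
    ∃ c : ι → ι → MvPolynomial (Fin N) ℂ, (∀ i j, c i j = - c j i) ∧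
      ∀ i ∈ s, a i = ∑ j ∈ s, c i j * f j

theorem skew_diag {c : ι → ι → MvPolynomial (Fin N) ℂ} (h : ∀ i j, c i j = - c j i) (i : ι) :
    c i i = 0 := self_eq_neg.mp (h i i)

theorem H1_congr {s : Finset ι} {f g : ι → MvPolynomial (Fin N) ℂ} (h : ∀ i ∈ s, f i = g i)
    (hf : H1 s f) : H1 s g := by
  intro a ha
  obtain ⟨c, hc, hc'⟩ := hf a (by rw [← ha]; exact Finset.sum_congr rfl fun i hi => by rw [h i hi])
  exact ⟨c, hc, fun i hi => by
    rw [hc' i hi]; exact Finset.sum_congr rfl fun i hi => by rw [h i hi]⟩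

theorem mem_span_image {s : Finset ι} {f : ι → MvPolynomial (Fin N) ℂ} {r : MvPolynomial (Fin N) ℂ} :
    r ∈ Ideal.span (f '' (s : Set ι)) ↔ ∃ a : ι → MvPolynomial (Fin N) ℂ, r = ∑ i ∈ s, a i * f i := by
  constructor
  · intro h
    obtain ⟨a, ha⟩ := (Submodule.mem_span_image_finset_iff_exists_fun _).mp h
    refine ⟨fun i => if h : i ∈ s then a ⟨i, h⟩ else 0, ?_⟩
    rw [← ha, ← Finset.sum_coe_sort s]
    exact Finset.sum_congr rfl fun i _ => by simp
  · rintro ⟨a, rfl⟩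
    exact Ideal.sum_mem _ fun i hi => Ideal.mul_mem_left _ _
      (Ideal.subset_span ⟨i, hi, rfl⟩)

theorem H1_nzd {s : Finset ι} {i : ι} (hi : i ∉ s) {f : ι → MvPolynomial (Fin N) ℂ}
    (h : H1 (insert i s) f) (r : MvPolynomial (Fin N) ℂ)
    (hr : r * f i ∈ Ideal.span (f '' (s : Set ι))) : r ∈ Ideal.span (f '' (s : Set ι)) := by
  obtain ⟨a, ha⟩ := mem_span_image.mp hr
  obtain ⟨c, hc, hc'⟩ := h (fun j => if j = i then r else - a j) (by
    rw [Finset.sum_insert hi, if_pos rfl, ha, ← Finset.sum_add_distrib]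
    apply Finset.sum_eq_zero
    intro j hj
    rw [if_neg (by rintro rfl; exact hi hj)]; ring)
  have := hc' i (Finset.mem_insert_self _ _)
  rw [if_pos rfl, Finset.sum_insert hi, skew_diag hc, zero_mul, zero_add] at this
  exact mem_span_image.mpr ⟨_, this⟩

theorem H1_insert {s : Finset ι} {i : ι} (hi : i ∉ s) {f : ι → MvPolynomial (Fin N) ℂ}
    (h : H1 s f) (hn : ∀ r, r * f i ∈ Ideal.span (f '' (s : Set ι)) → r ∈ Ideal.span (f '' (s : Set ι))) :
    H1 (insert i s) f := by
  intro a ha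
  rw [Finset.sum_insert hi] at ha
  obtain ⟨b, hb⟩ := mem_span_image.mp (hn (a i) (mem_span_image.mpr ⟨fun j => - a j, by
    simp only [neg_mul, Finset.sum_neg_distrib]; exact eq_neg_of_add_eq_zero_left ha⟩))
  obtain ⟨c, hc, hc'⟩ := h (fun j => a j + b j * f i) (by
    simp only [add_mul, Finset.sum_add_distrib]
    rw [← ha, add_comm, hb, Finset.sum_mul]
    congr 1
    exact Finset.sum_congr rfl fun j _ => by ring)
  refine ⟨fun j k => if j = i then (if k = i then 0 else b k) else
    (if k = i then - b j else c j k), ?_, ?_⟩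
  · intro j k
    by_cases h1 : j = i <;> by_cases h2 : k = i <;> simp [h1, h2]
    exact hc j k
  · intro j hj
    rw [Finset.sum_insert hi]
    by_cases h1 : j = i
    · subst h1
      simp only [if_true, zero_mul, zero_add]
      rw [hb]
      apply Finset.sum_congr rfl
      intro k hk
      rw [if_neg (by rintro rfl; exact hi hk)]
    · have hjs : j ∈ s := by simpa [h1] using hj
      have := hc' j hjs
      simp only [h1, if_false, if_true]
      rw [Finset.sum_congr rfl (g := fun k => c j k * f k)]
      · rw [← this]; ring
      · intro k hk
        rw [if_neg (by rintro rfl; exact hi hk)]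

theorem H1_drop {s : Finset ι} {i : ι} (hi : i ∉ s) {f : ι → MvPolynomial (Fin N) ℂ} (e : ι → ℕ)
    (hf : ∀ j, (f j).IsHomogeneous (e j)) (hei : 0 < e i)
    (h : H1 (insert i s) f) : H1 s f := by
  have key : ∀ D : ℕ, ∀ a : ι → MvPolynomial (Fin N) ℂ, (∀ j, T (e j) D (a j) = a j) →
      ∑ j ∈ s, a j * f j = 0 → ∃ c : ι → ι → MvPolynomial (Fin N) ℂ, (∀ i j, c i j = - c j i) ∧
      ∀ i ∈ s, a i = ∑ j ∈ s, c i j * f j := by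
    intro D
    induction D using Nat.strong_induction_on with
    | _ D ih =>
    intro a haT ha
    obtain ⟨c0, hc0, hc0'⟩ := h (fun j => if j = i then 0 else a j) (by
      rw [Finset.sum_insert hi, if_pos rfl, zero_mul, zero_add, ← ha]
      apply Finset.sum_congr rfl
      intro j hj
      rw [if_neg (by rintro rfl; exact hi hj)])
    obtain ⟨c, hcdef⟩ : ∃ c : ι → ι → MvPolynomial (Fin N) ℂ, c = fun j k => T (e j + e k) D (c0 j k) := ⟨_, rfl⟩
    have hc : ∀ j k, c j k = - c k j := by
      intro j k; simp only [hcdef]; rw [hc0 j k, T_neg, add_comm]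
    have hc' : ∀ j ∈ s, a j = c j i * f i + ∑ k ∈ s, c j k * f k := by
      intro j hj
      have := hc0' j (Finset.mem_insert_of_mem hj)
      rw [if_neg (by rintro rfl; exact hi hj)] at this
      rw [← haT j, this, T_sum, Finset.sum_insert hi]
      simp only [hcdef, T_mul _ _ _ _ _ (hf _)]
    have hrow : ∑ k ∈ s, c i k * f k = 0 := by
      have := hc0' i (Finset.mem_insert_self _ _)
      rw [if_pos rfl, Finset.sum_insert hi, skew_diag hc0, zero_mul, zero_add] at this
      have h2 := congrArg (T (e i) D) this
      rw [T_sum] at h2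
      simp only [T_mul _ _ _ _ _ (hf _)] at h2
      simp only [hcdef]
      rw [← h2]; simp [T]
    obtain ⟨d, hd, hd'⟩ : ∃ d : ι → ι → MvPolynomial (Fin N) ℂ, (∀ i j, d i j = - d j i) ∧
        ∀ k ∈ s, c i k = ∑ l ∈ s, d k l * f l := by
      by_cases hle : e i ≤ D
      · refine ih (D - e i) (by omega) (c i) ?_ hrow
        intro k
        simp only [hcdef]
        have : T (e i + e k) D (c0 i k) = T (e k) (D - e i) (c0 i k) := by
          unfold T
          by_cases h1 : e i + e k ≤ D
          · rw [if_pos h1, if_pos (by omega), Nat.sub_sub]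
          · rw [if_neg h1, if_neg (by omega)]
        rw [this]
        by_cases h1 : e k ≤ D - e i
        · exact T_self _ _ _ h1 (T_hom _ _ _)
        · simp [T, h1]
      · refine ⟨0, by simp, ?_⟩
        intro k _
        simp only [hcdef]
        unfold T; rw [if_neg (by omega)]; simp
    refine ⟨fun j k => c j k - f i * d j k, ?_, ?_⟩
    · intro j k
      change c j k - f i * d j k = -(c k j - f i * d k j)
      have h1 := hc j k
      have h2 := hd j k
      rw [h1, h2]; ring
    · intro j hj
      have h1 : ∑ k ∈ s, (c j k - f i * d j k) * f k =
          ∑ k ∈ s, c j k * f k - f i * ∑ k ∈ s, d j k * f k := by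
        rw [Finset.mul_sum, ← Finset.sum_sub_distrib]
        exact Finset.sum_congr rfl fun k _ => by ring
      have h2 := hd' j hj
      have h3 := hc' j hj
      have h4 := hc j i
      change a j = ∑ k ∈ s, (c j k - f i * d j k) * f k
      rw [h1, ← h2, h3, h4]; ring
  intro a ha
  have hT : ∀ D, ∑ j ∈ s, T (e j) D (a j) * f j = 0 := by
    intro D
    have := congrArg (homogeneousComponent D) ha
    rw [map_sum, map_zero] at this
    rw [← this]
    exact Finset.sum_congr rfl fun j _ => (hc_mul _ _ _ _ (hf j)).symm
  choose c hc hc' using fun D => key D (fun j => T (e j) D (a j)) (fun j => by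
    by_cases h1 : e j ≤ D
    · exact T_self _ _ _ h1 (T_hom _ _ _)
    · simp [T, h1]) (hT D)
  let M := ∑ j ∈ s, (e j + (a j).totalDegree + 1) + 1
  refine ⟨fun j k => ∑ D ∈ Finset.range M, c D j k, ?_, ?_⟩
  · intro j k; rw [← Finset.sum_neg_distrib]; exact Finset.sum_congr rfl fun D _ => hc D j k
  · intro j hj
    have hM : e j + (a j).totalDegree < M := by
      have := Finset.single_le_sum (f := fun j => e j + (a j).totalDegree + 1) (fun _ _ => Nat.zero_le _) hj
      simp only [M]; omega
    conv_lhs => rw [← T_total (e j) M (a j) hM]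
    simp only [Finset.sum_mul]
    rw [Finset.sum_comm]
    exact Finset.sum_congr rfl fun D _ => hc' D j hj

theorem H1_subset {s t : Finset ι} (hst : s ⊆ t) {f : ι → MvPolynomial (Fin N) ℂ} (e : ι → ℕ)
    (hf : ∀ j, (f j).IsHomogeneous (e j)) (he : ∀ j, 0 < e j)
    (h : H1 t f) : H1 s f := by
  induction hk : (t \ s).card generalizing t with
  | zero =>
    rw [Finset.card_eq_zero, Finset.sdiff_eq_empty_iff_subset] at hk
    rwa [Finset.Subset.antisymm hst hk]
  | succ k ih =>
    obtain ⟨i, hi⟩ : (t \ s).Nonempty := by rw [← Finset.card_pos]; omega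
    rw [Finset.mem_sdiff] at hi
    refine ih (t := t.erase i) (fun x hx => Finset.mem_erase.mpr ⟨by rintro rfl; exact hi.2 hx, hst hx⟩)
      (H1_drop (Finset.notMem_erase i t) e hf (he i) (by rwa [Finset.insert_erase hi.1])) ?_
    rw [Finset.erase_sdiff_comm, Finset.card_erase_of_mem (Finset.mem_sdiff.mpr hi)]; omega

end Koszul

theorem H1_X {N : ℕ} : H1 (Finset.univ : Finset (Fin N)) (fun i => (X i : MvPolynomial (Fin N) ℂ)) := by
  intro a ha
  have hD : ∀ D, ∑ i, X i * homogeneousComponent D (a i) = 0 := by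
    intro D
    have := congrArg (homogeneousComponent (D + 1)) ha
    rw [map_sum, map_zero] at this
    rw [← this]
    refine Finset.sum_congr rfl fun j _ => ?_
    rw [hc_mul 1 _ _ _ (isHomogeneous_X _ j)]
    simp [mul_comm]
  have key : ∀ D, ∀ i, homogeneousComponent D (a i) = ∑ j, (C ((D + 1 : ℂ)⁻¹) *
      (pderiv j (homogeneousComponent D (a i)) - pderiv i (homogeneousComponent D (a j)))) * X j := by
    intro D i
    have hE := (homogeneousComponent_isHomogeneous D (a i)).sum_X_mul_pderiv
    have h2 := congrArg (pderiv i) (hD D)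
    rw [map_sum, map_zero] at h2
    simp only [Derivation.leibniz, smul_eq_mul, Finset.sum_add_distrib, pderiv_X] at h2
    have h0 : ∑ x, homogeneousComponent D (a x) * (Pi.single i (1 : MvPolynomial (Fin N) ℂ) : Fin N → _) x
        = homogeneousComponent D (a i) := by simp [Pi.single_apply]
    rw [h0] at h2
    have h3 : ∑ j, (C ((D + 1 : ℂ)⁻¹) *
      (pderiv j (homogeneousComponent D (a i)) - pderiv i (homogeneousComponent D (a j)))) * X j
      = C ((D + 1 : ℂ)⁻¹) * (∑ j, X j * pderiv j (homogeneousComponent D (a i))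
        - ∑ j, X j * pderiv i (homogeneousComponent D (a j))) := by
      rw [← Finset.sum_sub_distrib, Finset.mul_sum]
      exact Finset.sum_congr rfl fun j _ => by ring
    rw [h3, hE, eq_neg_of_add_eq_zero_left h2]
    simp only [sub_neg_eq_add]
    rw [nsmul_eq_mul, ← add_one_mul, ← mul_assoc]
    have : (C ((D + 1 : ℂ)⁻¹) * ((D : MvPolynomial (Fin N) ℂ) + 1)) = 1 := by
      have h5 : ((D : MvPolynomial (Fin N) ℂ) + 1) = C ((D : ℂ) + 1) := by simp
      rw [h5, ← C_mul, inv_mul_cancel₀ (Nat.cast_add_one_ne_zero D), C_1]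
    rw [this, one_mul]
  let M := ∑ j, ((a j).totalDegree + 1) + 1
  refine ⟨fun i j => ∑ D ∈ Finset.range M, C ((D + 1 : ℂ)⁻¹) *
      (pderiv j (homogeneousComponent D (a i)) - pderiv i (homogeneousComponent D (a j))), ?_, ?_⟩
  · intro i j; rw [← Finset.sum_neg_distrib]; exact Finset.sum_congr rfl fun D _ => by ring
  · intro i _
    have hM : 0 + (a i).totalDegree < M := by
      have := Finset.single_le_sum (f := fun j => (a j).totalDegree + 1) (fun _ _ => Nat.zero_le _) (Finset.mem_univ i)
      simp only [M]; omega
    conv_lhs => rw [← T_total 0 M (a i) hM]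
    simp only [Finset.sum_mul]
    rw [Finset.sum_comm]
    exact Finset.sum_congr rfl fun D _ => by rw [T_zero]; exact key D i

end TI

namespace TI

theorem H1_linear {N : ℕ} {f g : Fin N → MvPolynomial (Fin N) ℂ}
    (T U : Matrix (Fin N) (Fin N) (MvPolynomial (Fin N) ℂ)) (hTU : T * U = 1)
    (hf : f = U.mulVec g) (hfg : g = T.mulVec f)
    (h : H1 Finset.univ f) : H1 Finset.univ g := by
  intro a ha
  have h1 : dotProduct a g = 0 := ha
  rw [hfg, Matrix.dotProduct_mulVec] at h1
  obtain ⟨c, hc, hc'⟩ := h (Matrix.vecMul a T) h1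
  let c1 : Matrix (Fin N) (Fin N) (MvPolynomial (Fin N) ℂ) := Matrix.of c
  have hc1 : c1.transpose = - c1 := by
    apply Matrix.ext
    intro i j
    exact hc j i
  have h2 : Matrix.vecMul a T = c1.mulVec f := by
    ext1 i
    exact hc' i (Finset.mem_univ _)
  have h3 : a = (U.transpose * c1 * U).mulVec g := by
    calc a = Matrix.vecMul (Matrix.vecMul a T) U := by rw [Matrix.vecMul_vecMul, hTU, Matrix.vecMul_one]
      _ = _ := by
        rw [h2]
        conv_lhs => rw [hf]
        rw [Matrix.mulVec_mulVec, ← Matrix.mulVec_transpose, Matrix.mulVec_mulVec, Matrix.mul_assoc]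
  refine ⟨U.transpose * c1 * U, ?_, fun i _ => congrFun h3 i⟩
  intro i j
  have h4 : (U.transpose * c1 * U).transpose = - (U.transpose * c1 * U) := by
    rw [Matrix.transpose_mul, Matrix.transpose_mul, Matrix.transpose_transpose, hc1]
    simp [Matrix.mul_assoc]
  have := congrFun (congrFun h4 j) i
  exact this

theorem exchange {N : ℕ} {f : Fin N → MvPolynomial (Fin N) ℂ} (e : Fin N → ℕ)
    (hf : ∀ j, (f j).IsHomogeneous (e j)) (he : ∀ j, 0 < e j)
    (h : H1 Finset.univ f) (i : Fin N)
    (V : Submodule ℂ (MvPolynomial (Fin N) ℂ))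
    (M : ℕ) (hM : f i ^ M ∈ Ideal.span (V : Set (MvPolynomial (Fin N) ℂ)) ⊔ Ideal.span (f '' {i}ᶜ))
    (P : Set (Ideal (MvPolynomial (Fin N) ℂ))) (hP : P.Finite)
    (hPV : ∀ p ∈ P, ¬ ∀ v ∈ V, v ∈ p) :
    ∃ G ∈ V, H1 Finset.univ (Function.update f i G) ∧ ∀ p ∈ P, G ∉ p := by
  classical
  have hcoe : ((Finset.univ.erase i : Finset (Fin N)) : Set (Fin N)) = {i}ᶜ := by
    ext x; simp
  obtain ⟨I, hI⟩ : ∃ I, I = Ideal.span (f '' ((Finset.univ.erase i : Finset (Fin N)) : Set (Fin N))) := ⟨_, rfl⟩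
  have hins : insert i (Finset.univ.erase i) = Finset.univ := Finset.insert_erase (Finset.mem_univ _)
  have hnz : ∀ r, r * f i ∈ I → r ∈ I := by
    rw [hI]
    exact H1_nzd (Finset.notMem_erase i _) (by rwa [hins])
  have hAssfin := associatedPrimes.finite (MvPolynomial (Fin N) ℂ) (MvPolynomial (Fin N) ℂ ⧸ I)
  have hAssV : ∀ p ∈ associatedPrimes (MvPolynomial (Fin N) ℂ) (MvPolynomial (Fin N) ℂ ⧸ I),
      ¬ ∀ v ∈ V, v ∈ p := by
    intro p hp hv
    have hpr : p.IsPrime := hp.isPrime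
    have hIp : I ≤ p := by
      intro x hx
      apply IsAssociatedPrime.annihilator_le hp
      rw [Submodule.mem_annihilator]
      intro y _
      obtain ⟨y, rfl⟩ := Ideal.Quotient.mk_surjective y
      change Ideal.Quotient.mk I (x * y) = 0
      rw [Ideal.Quotient.eq_zero_iff_mem]
      exact Ideal.mul_mem_right _ _ hx
    have h1 : f i ∈ p := by
      apply hpr.mem_of_pow_mem M
      refine (sup_le ?_ ?_ : _ ≤ p) hM
      · exact Ideal.span_le.mpr hv
      · rw [← hcoe, ← hI]; exact hIp
    have h2 : f i ∈ {r | ∃ x : MvPolynomial (Fin N) ℂ ⧸ I, x ≠ 0 ∧ r • x = 0} := by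
      rw [← biUnion_associatedPrimes_eq_zero_divisors]
      exact Set.mem_biUnion hp h1
    obtain ⟨x, hx, hx2⟩ := h2
    obtain ⟨y, rfl⟩ := Ideal.Quotient.mk_surjective x
    change Ideal.Quotient.mk I (f i * y) = 0 at hx2
    rw [Ideal.Quotient.eq_zero_iff_mem, mul_comm] at hx2
    exact hx (Ideal.Quotient.eq_zero_iff_mem.mpr (hnz _ hx2))
  have hfin := hP.union hAssfin
  let s : Finset (Subspace ℂ V) := hfin.toFinset.image
    (fun p => (Submodule.restrictScalars ℂ p).comap V.subtype)
  have hs : ⊤ ∉ s := by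
    intro hmem
    obtain ⟨p, hp, hp2⟩ := Finset.mem_image.mp hmem
    rw [Set.Finite.mem_toFinset] at hp
    have : ∀ v ∈ V, v ∈ p := by
      intro v hv
      have : (⟨v, hv⟩ : V) ∈ (⊤ : Submodule ℂ V) := trivial
      rw [← hp2] at this
      exact this
    rcases hp with hp | hp
    · exact hPV p hp this
    · exact hAssV p hp this
  have hne := Subspace.biUnion_ne_univ_of_top_notMem hs
  rw [Set.ne_univ_iff_exists_notMem] at hne
  obtain ⟨⟨G, hGV⟩, hG⟩ := hne
  have hG' : ∀ p ∈ P ∪ associatedPrimes (MvPolynomial (Fin N) ℂ) (MvPolynomial (Fin N) ℂ ⧸ I), G ∉ p := by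
    intro p hp hGp
    apply hG
    refine Set.mem_biUnion (x := (Submodule.restrictScalars ℂ p).comap V.subtype) ?_ hGp
    exact Finset.mem_image.mpr ⟨p, by rwa [Set.Finite.mem_toFinset], rfl⟩
  refine ⟨G, hGV, ?_, fun p hp => hG' p (Or.inl hp)⟩
  have himg : Function.update f i G '' ((Finset.univ.erase i : Finset (Fin N)) : Set (Fin N))
      = f '' ((Finset.univ.erase i : Finset (Fin N)) : Set (Fin N)) := by
    apply Set.image_congr
    intro a ha
    rw [Function.update_of_ne]
    simpa using ha
  rw [← hins]
  apply H1_insert (Finset.notMem_erase i _)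
  · refine H1_congr (f := f) ?_ (H1_drop (Finset.notMem_erase i _) e hf (he i) (by rwa [hins]))
    intro a ha
    rw [Function.update_of_ne (by simpa using ha)]
  · rw [himg, ← hI, Function.update_self]
    intro r hr
    by_contra hrI
    have h2 : G ∈ {r | ∃ x : MvPolynomial (Fin N) ℂ ⧸ I, x ≠ 0 ∧ r • x = 0} := by
      refine ⟨Ideal.Quotient.mk I r, fun h0 => hrI (Ideal.Quotient.eq_zero_iff_mem.mp h0), ?_⟩
      change Ideal.Quotient.mk I (G * r) = 0
      rw [Ideal.Quotient.eq_zero_iff_mem, mul_comm]; exact hr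
    rw [← biUnion_associatedPrimes_eq_zero_divisors, Set.mem_iUnion₂] at h2
    obtain ⟨p, hp, hp2⟩ := h2
    exact hG' p (Or.inr hp) hp2

theorem exchange_multi {N : ℕ} {f0 : Fin N → MvPolynomial (Fin N) ℂ} (e : Fin N → ℕ)
    (hf : ∀ j, (f0 j).IsHomogeneous (e j)) (he : ∀ j, 0 < e j)
    (h : H1 Finset.univ f0) (s : Finset (Fin N)) (d : ℕ) (hd : 0 < d)
    (V : Submodule ℂ (MvPolynomial (Fin N) ℂ)) (hV : ∀ v ∈ V, v.IsHomogeneous d)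
    (hM : ∀ i ∈ s, ∃ M, f0 i ^ M ∈ Ideal.span (V : Set (MvPolynomial (Fin N) ℂ)) ⊔
      Ideal.span (f0 '' (s : Set (Fin N))ᶜ)) :
    ∃ f : Fin N → MvPolynomial (Fin N) ℂ, H1 Finset.univ f ∧ (∀ i ∉ s, f i = f0 i) ∧ ∀ i ∈ s, f i ∈ V := by
  classical
  have key : ∀ t ⊆ s, ∃ f : Fin N → MvPolynomial (Fin N) ℂ, H1 Finset.univ f ∧
      (∀ i ∉ t, f i = f0 i) ∧ ∀ i ∈ t, f i ∈ V := by
    intro t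
    induction t using Finset.induction_on with
    | empty => intro _; exact ⟨f0, h, by simp, by simp⟩
    | insert i t hi ih =>
      intro hts
      obtain ⟨f, h1, h2, h3⟩ := ih (fun x hx => hts (Finset.mem_insert_of_mem hx))
      obtain ⟨M, hM⟩ := hM i (hts (Finset.mem_insert_self _ _))
      obtain ⟨G, hG, hG2, -⟩ := exchange (f := f) (fun j => if j ∈ t then d else e j)
        (fun j => by
          by_cases hj : j ∈ t
          · rw [if_pos hj]; exact hV _ (h3 j hj)
          · rw [if_neg hj, h2 j hj]; exact hf j)
        (fun j => by split_ifs; exacts [hd, he j]) h1 i V M (by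
          rw [h2 i hi]
          have hmono : Ideal.span (f0 '' (s : Set (Fin N))ᶜ) ≤ Ideal.span (f '' {i}ᶜ) := by
            refine Ideal.span_mono ?_
            rintro _ ⟨j, hj, rfl⟩
            refine ⟨j, ?_, h2 j fun hjt => hj (hts (Finset.mem_insert_of_mem hjt))⟩
            rintro rfl
            exact hj (hts (Finset.mem_insert_self _ _))
          exact (sup_le_sup_left hmono (Ideal.span (V : Set (MvPolynomial (Fin N) ℂ)))) hM) ∅ Set.finite_empty (by simp)
      refine ⟨_, hG2, ?_, ?_⟩
      · intro j hj
        rw [Finset.mem_insert, not_or] at hj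
        rw [Function.update_of_ne hj.1, h2 j hj.2]
      · intro j hj
        by_cases hji : j = i
        · subst hji; rwa [Function.update_self]
        · rw [Function.update_of_ne hji]
          exact h3 j (by simpa [hji] using hj)
  exact key s (Finset.Subset.refl _)

end TI

namespace TI

theorem nullst {N : ℕ} (I : Ideal (MvPolynomial (Fin N) ℂ))
    (h : ∀ p : Fin N → ℂ, (∀ g ∈ I, eval p g = 0) → p = 0) (i : Fin N) :
    ∃ M : ℕ, (X i : MvPolynomial (Fin N) ℂ) ^ M ∈ I := by
  have h1 : (X i : MvPolynomial (Fin N) ℂ) ∈ I.radical := by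
    rw [← vanishingIdeal_zeroLocus_eq_radical (K := ℂ), mem_vanishingIdeal_iff]
    intro p hp
    have : p = 0 := h p fun g hg => by
      have := hp g hg
      rwa [aeval_eq_eval] at this
    rw [this]; simp
  exact h1

theorem H1_endo {N q : ℕ} (hq : 0 < q) (F : Fin N → MvPolynomial (Fin N) ℂ)
    (hF : ∀ i, (F i).IsHomogeneous q)
    (hF0 : ∀ x : Fin N → ℂ, (∀ i, eval x (F i) = 0) → x = 0) : H1 Finset.univ F := by
  classical
  obtain ⟨G, hG, -, hGV⟩ := exchange_multi (f0 := fun i => (X i : MvPolynomial (Fin N) ℂ)) (fun _ => 1)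
    (fun j => isHomogeneous_X _ j) (fun _ => one_pos) H1_X Finset.univ q hq
    (Submodule.span ℂ (Set.range F)) (by
      intro v hv
      have : Submodule.span ℂ (Set.range F) ≤ homogeneousSubmodule (Fin N) ℂ q := by
        rw [Submodule.span_le]; rintro _ ⟨i, rfl⟩; exact hF i
      exact this hv) (by
      intro i _
      obtain ⟨M, hM⟩ := nullst (Ideal.span (Submodule.span ℂ (Set.range F) : Set (MvPolynomial (Fin N) ℂ))) (by
        intro p hp
        apply hF0
        intro i
        exact hp _ (Ideal.subset_span (Submodule.subset_span ⟨i, rfl⟩))) i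
      exact ⟨M, Ideal.mem_sup_left hM⟩)
  have hGh : ∀ i, (G i).IsHomogeneous q := by
    intro i
    have : Submodule.span ℂ (Set.range F) ≤ homogeneousSubmodule (Fin N) ℂ q := by
      rw [Submodule.span_le]; rintro _ ⟨i, rfl⟩; exact hF i
    exact this (hGV i (Finset.mem_univ _))
  have hU : ∀ i, ∃ u : Fin N → ℂ, ∑ j, u j • F j = G i := by
    intro i
    exact (Submodule.mem_span_range_iff_exists_fun ℂ).mp (hGV i (Finset.mem_univ _))
  choose U hU using hU
  have hinj : Function.Injective (Matrix.vecMul · (Matrix.of U)) := by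
    have : Function.Injective (Matrix.vecMulLinear (Matrix.of U)) := by
      rw [injective_iff_map_eq_zero]
      intro v hv
      have h1 : ∑ i, (C (v i) : MvPolynomial (Fin N) ℂ) * G i = 0 := by
        have h2 : ∑ i, (C (v i) : MvPolynomial (Fin N) ℂ) * G i = ∑ j, (Matrix.vecMul v (Matrix.of U) j) • F j := by
          simp_rw [← hU, Matrix.vecMul, dotProduct, Finset.sum_smul, Finset.mul_sum]
          rw [Finset.sum_comm]
          refine Finset.sum_congr rfl fun j _ => Finset.sum_congr rfl fun i _ => ?_
          rw [← smul_eq_C_mul, smul_smul]; rfl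
        rw [h2]
        have h3 : Matrix.vecMul v (Matrix.of U) = 0 := hv
        simp [h3]
      obtain ⟨c, -, hc⟩ := hG _ h1
      funext i
      have := congrArg (constantCoeff) (hc i (Finset.mem_univ _))
      rw [constantCoeff_C, map_sum] at this
      rw [this]
      apply Finset.sum_eq_zero
      intro j _
      rw [map_mul]
      have h0 : constantCoeff (G j) = 0 := by
        rw [constantCoeff_eq]
        exact (hGh j).coeff_eq_zero (by simp; omega)
      rw [h0, mul_zero]
    exact this
  rw [Matrix.vecMul_injective_iff_isUnit] at hinj
  obtain ⟨T, hT⟩ := hinj.exists_left_inv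
  let CM : Matrix (Fin N) (Fin N) ℂ →+* Matrix (Fin N) (Fin N) (MvPolynomial (Fin N) ℂ) :=
    (C : ℂ →+* MvPolynomial (Fin N) ℂ).mapMatrix
  have hTU : CM T * CM (Matrix.of U) = 1 := by rw [← map_mul, hT, map_one]
  have hGF : G = (CM (Matrix.of U)).mulVec F := by
    funext i
    rw [← hU i]
    simp only [Matrix.mulVec, dotProduct]
    refine Finset.sum_congr rfl fun j _ => ?_
    rw [smul_eq_C_mul]; rfl
  refine H1_linear (CM T) (CM (Matrix.of U)) hTU hGF ?_ hG
  rw [hGF, Matrix.mulVec_mulVec, hTU, Matrix.one_mulVec]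

theorem exists_basis {N : ℕ} (I : Ideal (MvPolynomial (Fin N) ℂ))
    (hI : ∀ i, ∃ M : ℕ, (X i : MvPolynomial (Fin N) ℂ) ^ M ∈ I) :
    ∃ (κ : Type) (_ : Fintype κ) (e : κ → MvPolynomial (Fin N) ℂ) (d : κ → ℕ),
      (∀ j, (e j).IsHomogeneous (d j)) ∧
      (∀ s, ∃ c : κ → ℂ, s - ∑ j, c j • e j ∈ I) ∧
      (∀ c : κ → ℂ, ∑ j, c j • e j ∈ I → c = 0) := by
  classical
  choose M hM using hI
  let mk : MvPolynomial (Fin N) ℂ →ₗ[ℂ] MvPolynomial (Fin N) ℂ ⧸ I := (Ideal.Quotient.mkₐ ℂ I).toLinearMap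
  have hmk : ∀ x, mk x = 0 ↔ x ∈ I := fun x => Ideal.Quotient.eq_zero_iff_mem
  let v : (Fin N →₀ ℕ) → MvPolynomial (Fin N) ℂ ⧸ I := fun m => mk (monomial m 1)
  obtain ⟨κ, a, ha, hspan, hli⟩ := exists_linearIndependent' ℂ v
  have hlt : ∀ j i, a j i < M i := by
    intro j i
    by_contra hle
    rw [not_lt] at hle
    apply hli.ne_zero j
    change mk _ = 0
    rw [hmk]
    have : monomial (a j) (1 : ℂ) = X i ^ M i * monomial (a j - Finsupp.single i (M i)) 1 := by
      rw [X_pow_eq_monomial, monomial_mul, one_mul]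
      congr 2
      rw [add_tsub_cancel_of_le]
      rwa [Finsupp.single_le_iff]
    rw [this]
    exact Ideal.mul_mem_right _ _ (hM i)
  have hfin : Finite κ := by
    let g : κ → ∀ i : Fin N, Fin (M i) := fun j i => ⟨a j i, hlt j i⟩
    apply Finite.of_injective g
    intro x y hxy
    apply ha
    ext i
    exact congrArg Fin.val (congrFun hxy i)
  have := Fintype.ofFinite κ
  have hsp : ∀ x, mk x ∈ Submodule.span ℂ (Set.range v) := by
    intro x
    have h1 : x ∈ Submodule.span ℂ (Set.range fun m : Fin N →₀ ℕ => monomial m (1 : ℂ)) := by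
      rw [as_sum x]
      refine Submodule.sum_mem _ fun m _ => ?_
      have : monomial m (coeff m x) = coeff m x • monomial m (1 : ℂ) := by
        rw [smul_monomial, smul_eq_mul, mul_one]
      rw [this]
      exact Submodule.smul_mem _ _ (Submodule.subset_span ⟨m, rfl⟩)
    have h2 := Submodule.mem_map_of_mem (f := mk) h1
    rw [Submodule.map_span, ← Set.range_comp] at h2
    exact h2
  let eqv : κ ≃ Fin (Fintype.card κ) := Fintype.equivFin κ
  refine ⟨Fin (Fintype.card κ), inferInstance, fun j => monomial (a (eqv.symm j)) 1, fun j => (a (eqv.symm j)).degree, ?_, ?_, ?_⟩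
  · intro j
    exact isHomogeneous_monomial _ rfl
  · intro s
    have := hsp s
    rw [← hspan, Submodule.mem_span_range_iff_exists_fun] at this
    obtain ⟨c, hc⟩ := this
    refine ⟨fun j => c (eqv.symm j), ?_⟩
    rw [← hmk, map_sub, ← hc, map_sum, Equiv.sum_comp eqv.symm (fun j => mk (c j • monomial (a j) 1)), sub_eq_zero]
    refine Finset.sum_congr rfl fun j _ => ?_
    rw [map_smul]; rfl
  · intro c hc
    rw [← hmk, map_sum] at hc
    have h3 := Fintype.linearIndependent_iff.mp hli (fun j => c (eqv j)) (by
      rw [← hc, ← Equiv.sum_comp eqv]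
      refine Finset.sum_congr rfl fun j _ => ?_
      rw [map_smul]; simp only [Equiv.symm_apply_apply]; rfl)
    funext j
    have := h3 (eqv.symm j)
    rwa [Equiv.apply_symm_apply] at this


theorem freeness {N q : ℕ} (hq : 0 < q) (F : Fin N → MvPolynomial (Fin N) ℂ)
    (hF : ∀ i, (F i).IsHomogeneous q)
    (hF0 : ∀ x : Fin N → ℂ, (∀ i, eval x (F i) = 0) → x = 0) :
    ∃ (κ : Type) (_ : Fintype κ) (e : κ → MvPolynomial (Fin N) ℂ),
      (∀ D s, s.totalDegree ≤ D → ∃ p : κ → MvPolynomial (Fin N) ℂ,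
        s = ∑ j, e j * aeval F (p j) ∧ ∀ j, q * (p j).totalDegree ≤ D) ∧
      (∀ p : κ → MvPolynomial (Fin N) ℂ, ∑ j, e j * aeval F (p j) = 0 → p = 0) := by
  classical
  have hH1 := H1_endo hq F hF hF0
  obtain ⟨κ, hκ, e, d, hed, hgen, hind⟩ := exists_basis (Ideal.span (Set.range F)) (nullst _ (by
    intro p hp
    exact hF0 p fun i => hp _ (Ideal.subset_span ⟨i, rfl⟩)))
  refine ⟨κ, hκ, e, ?_, ?_⟩
  · have hom : ∀ D (s : MvPolynomial (Fin N) ℂ), s.IsHomogeneous D → ∃ p : κ → MvPolynomial (Fin N) ℂ,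
        s = ∑ j, e j * aeval F (p j) ∧ ∀ j, q * (p j).totalDegree ≤ D := by
      intro D
      induction D using Nat.strong_induction_on with
      | _ D ih =>
      intro s hs
      obtain ⟨c, hc⟩ := hgen s
      obtain ⟨a, ha⟩ := (Ideal.mem_span_range_iff_exists_fun).mp hc
      have h1 : s = ∑ j, e j * C (if d j = D then c j else 0) + ∑ i, T q D (a i) * F i := by
        have h2 := congrArg (homogeneousComponent D) ha
        rw [map_sum, map_sub, homogeneousComponent_eq_self hs, map_sum] at h2
        have h3 : ∀ i, homogeneousComponent D (a i * F i) = T q D (a i) * F i := fun i =>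
          hc_mul _ _ _ _ (hF i)
        simp_rw [h3] at h2
        rw [h2]
        have h4 : ∀ j, homogeneousComponent D (c j • e j) = e j * C (if d j = D then c j else 0) := by
          intro j
          rw [map_smul, homogeneousComponent_of_mem ((mem_homogeneousSubmodule _ _).mpr (hed j))]
          by_cases h : D = d j
          · rw [if_pos h, if_pos h.symm, smul_eq_C_mul, mul_comm]
          · rw [if_neg h, if_neg (Ne.symm h)]; simp
        simp_rw [h4]
        ring
      by_cases hD : q ≤ D
      · have h5 : ∀ i, ∃ p : κ → MvPolynomial (Fin N) ℂ,
            T q D (a i) = ∑ j, e j * aeval F (p j) ∧ ∀ j, q * (p j).totalDegree ≤ D - q :=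
          fun i => ih (D - q) (by omega) _ (T_hom _ _ _)
        choose p hp hp2 using h5
        refine ⟨fun j => C (if d j = D then c j else 0) + ∑ i, p i j * X i, ?_, ?_⟩
        · conv_lhs => rw [h1]
          simp only [map_add, map_sum, map_mul, aeval_X, mul_add, Finset.sum_add_distrib, algHom_C,
            algebraMap_eq, Finset.mul_sum]
          congr 1
          rw [Finset.sum_comm]
          refine Finset.sum_congr rfl fun i _ => ?_
          conv_lhs => rw [hp i, Finset.sum_mul]
          exact Finset.sum_congr rfl fun j _ => by ring
        · intro j
          have h6 : (C (if d j = D then c j else 0) + ∑ i, p i j * X i).totalDegree ≤ D / q := by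
            refine (totalDegree_add _ _).trans (max_le (by simp) ?_)
            refine totalDegree_finsetSum_le fun i _ => ?_
            refine (totalDegree_mul _ _).trans ?_
            rw [totalDegree_X]
            have := hp2 i j
            rw [Nat.le_div_iff_mul_le hq, add_mul, mul_comm _ q]
            omega
          rw [Nat.le_div_iff_mul_le hq, mul_comm] at h6
          exact h6
      · refine ⟨fun j => C (if d j = D then c j else 0), ?_, by simp⟩
        conv_lhs => rw [h1]
        have h7 : ∀ i, T q D (a i) = 0 := fun i => by simp [T, hD]
        simp [h7, algHom_C]
    intro D s hs
    choose p hp hp2 using fun k => hom k _ (homogeneousComponent_isHomogeneous k s)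
    refine ⟨fun j => ∑ k ∈ Finset.range (s.totalDegree + 1), p k j, ?_, ?_⟩
    · conv_lhs => rw [← sum_homogeneousComponent s]
      simp only [map_sum, Finset.mul_sum]
      rw [Finset.sum_comm]
      exact Finset.sum_congr rfl fun k _ => hp k
    · intro j
      have h6 : (∑ k ∈ Finset.range (s.totalDegree + 1), p k j).totalDegree ≤ D / q := by
        refine totalDegree_finsetSum_le fun k hk => ?_
        rw [Finset.mem_range] at hk
        have := hp2 k j
        rw [Nat.le_div_iff_mul_le hq, mul_comm _ q]
        omega
      rw [Nat.le_div_iff_mul_le hq, mul_comm] at h6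
      exact h6
  · have hnz : ∀ k : Fin N, ∀ r, r * F k ∈ Ideal.span (F '' {i | (k : ℕ) + 1 ≤ i}) →
        r ∈ Ideal.span (F '' {i | (k : ℕ) + 1 ≤ i}) := by
      intro k r hr
      have hco : ((Finset.univ.filter fun i : Fin N => (k : ℕ) + 1 ≤ i : Finset (Fin N)) : Set (Fin N))
          = {i : Fin N | (k : ℕ) + 1 ≤ (i : ℕ)} := by ext; simp
      rw [← hco] at hr ⊢
      refine H1_nzd (i := k) (by simp) (H1_subset (Finset.subset_univ _) (fun _ => q) hF (fun _ => hq) hH1) r hr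
    have claim : ∀ k : ℕ, k ≤ N → ∀ p : κ → MvPolynomial (Fin N) ℂ,
        (∀ j m, (∃ i : Fin N, k ≤ i ∧ m i ≠ 0) → coeff m (p j) = 0) →
        ∑ j, e j * aeval F (p j) ∈ Ideal.span (F '' {i | k ≤ i}) → p = 0 := by
      intro k
      induction k with
      | zero =>
        intro _ p hp hmem
        have h1 : ∀ j, p j = C (coeff 0 (p j)) := by
          intro j
          ext m
          rw [coeff_C]
          split_ifs with h0
          · rw [h0]
          · apply hp
            by_contra hcon
            push Not at hcon
            apply h0
            ext i
            exact (hcon i (Nat.zero_le _)).symm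
        have h2 := hind (fun j => coeff 0 (p j)) (by
          have hs : F '' {i : Fin N | 0 ≤ (i : ℕ)} = Set.range F := by
            rw [← Set.image_univ]; congr 1; ext; simp
          rw [← hs]
          convert hmem using 2 with j
          conv_rhs => rw [h1 j]
          rw [algHom_C, smul_eq_C_mul, mul_comm]; rfl)
        funext j
        rw [h1 j, show coeff 0 (p j) = 0 from congrFun h2 j]; simp
      | succ k ih =>
        intro hk
        have key : ∀ D : ℕ, ∀ p : κ → MvPolynomial (Fin N) ℂ,
            (∀ j m, D ≤ m.degree → coeff m (p j) = 0) →
            (∀ j m, (∃ i : Fin N, k + 1 ≤ i ∧ m i ≠ 0) → coeff m (p j) = 0) →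
            ∑ j, e j * aeval F (p j) ∈ Ideal.span (F '' {i | k + 1 ≤ i}) → p = 0 := by
          intro D
          induction D with
          | zero =>
            intro p hp _ _
            funext j; ext m; exact hp j m (Nat.zero_le _)
          | succ D ihD =>
            intro p hpD hp hmem
            let k' : Fin N := ⟨k, hk⟩
            have hdec : ∀ j, p j = X k' * (p j).divMonomial (Finsupp.single k' 1)
                + (p j).modMonomial (Finsupp.single k' 1) := fun j => (divMonomial_add_modMonomial_single (p j) k').symm
            have hsum : ∑ j, e j * aeval F (p j) =
                (∑ j, e j * aeval F ((p j).divMonomial (Finsupp.single k' 1))) * F k'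
                + ∑ j, e j * aeval F ((p j).modMonomial (Finsupp.single k' 1)) := by
              rw [Finset.sum_mul, ← Finset.sum_add_distrib]
              refine Finset.sum_congr rfl fun j _ => ?_
              conv_lhs => rw [hdec j, map_add, map_mul, aeval_X]
              ring
            have hr : (fun j => (p j).modMonomial (Finsupp.single k' 1)) = 0 := by
              apply ih (by omega)
              · rintro j m ⟨i, hi, hmi⟩
                by_cases hle : Finsupp.single k' 1 ≤ m
                · exact coeff_modMonomial_of_le _ hle
                · rw [coeff_modMonomial_of_not_le _ hle]
                  apply hp
                  refine ⟨i, ?_, hmi⟩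
                  rcases Nat.lt_or_ge k i with h | h
                  · exact h
                  · exfalso
                    apply hle
                    rw [Finsupp.single_le_iff]
                    have : i = k' := Fin.ext (le_antisymm h hi)
                    rw [← this]; omega
              · have hmono : Ideal.span (F '' {i : Fin N | k + 1 ≤ i}) ≤ Ideal.span (F '' {i : Fin N | k ≤ i}) :=
                  Ideal.span_mono (Set.image_mono fun i hi => by
                    change k + 1 ≤ (i : ℕ) at hi; change k ≤ (i : ℕ); omega)
                have h3 := hmono hmem
                rw [hsum] at h3
                have h4 : F k' ∈ Ideal.span (F '' {i : Fin N | k ≤ i}) := Ideal.subset_span ⟨k', le_refl k, rfl⟩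
                exact (Ideal.add_mem_iff_right _ (Ideal.mul_mem_left _ _ h4)).mp h3
            have hr' : ∀ j, (p j).modMonomial (Finsupp.single k' 1) = 0 := fun j => congrFun hr j
            have hp' : (fun j => (p j).divMonomial (Finsupp.single k' 1)) = 0 := by
              apply ihD
              · intro j m hm
                rw [coeff_divMonomial]
                apply hpD
                rw [map_add, Finsupp.degree_single]; omega
              · rintro j m ⟨i, hi, hmi⟩
                rw [coeff_divMonomial]
                apply hp
                exact ⟨i, hi, by simp; omega⟩
              · apply hnz k'
                rw [hsum] at hmem
                simp only [hr', map_zero, mul_zero, Finset.sum_const_zero, add_zero] at hmem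
                exact hmem
            funext j
            rw [hdec j, hr' j, show (p j).divMonomial (Finsupp.single k' 1) = 0 from congrFun hp' j]
            simp
        intro p hp hmem
        refine key (∑ j, (p j).totalDegree + 1) p ?_ hp hmem
        intro j m hm
        apply coeff_eq_zero_of_totalDegree_lt
        have := Finset.single_le_sum (f := fun j => (p j).totalDegree) (fun _ _ => Nat.zero_le _) (Finset.mem_univ j)
        have h9 : m.degree = ∑ i ∈ m.support, m i := rfl
        rw [← h9]
        omega
    intro p hp
    apply claim N le_rfl p
    · rintro j m ⟨i, hi, -⟩
      exact absurd i.2 (by omega)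
    · rw [hp]; exact Ideal.zero_mem _

end TI

namespace TI

theorem chain {N : ℕ} (D : Derivation ℂ (MvPolynomial (Fin N) ℂ) (MvPolynomial (Fin N) ℂ))
    (F : Fin N → MvPolynomial (Fin N) ℂ) (p : MvPolynomial (Fin N) ℂ) :
    D (aeval F p) = ∑ i, aeval F (pderiv i p) * D (F i) := by
  classical
  induction p using MvPolynomial.induction_on with
  | C a => simp [algHom_C]
  | add p q hp hq => simp only [map_add, hp, hq, add_mul, Finset.sum_add_distrib]
  | mul_X p k hp =>
    rw [map_mul, aeval_X, Derivation.leibniz, hp]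
    simp only [Derivation.leibniz, smul_eq_mul, map_add, map_mul, aeval_X, add_mul,
      Finset.sum_add_distrib, Finset.mul_sum]
    congr 1
    · rw [Finset.sum_eq_single k]
      · simp
      · intro b _ hb; rw [pderiv_X_of_ne (Ne.symm hb)]; simp
      · simp
    · exact Finset.sum_congr rfl fun i _ => by ring

/-- the derivation with coefficients a -/
noncomputable def der {N : ℕ} (a : Fin N → MvPolynomial (Fin N) ℂ) :
    Derivation ℂ (MvPolynomial (Fin N) ℂ) (MvPolynomial (Fin N) ℂ) := mkDerivation ℂ a

theorem der_apply {N : ℕ} (a : Fin N → MvPolynomial (Fin N) ℂ) (p : MvPolynomial (Fin N) ℂ) :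
    der a p = ∑ i, a i * pderiv i p := by
  have := chain (der a) X p
  rw [aeval_X_left_apply] at this
  rw [this]
  refine Finset.sum_congr rfl fun i _ => ?_
  rw [aeval_X_left_apply, der, mkDerivation_X, mul_comm]

theorem dF_inj {N : ℕ} (F : Fin N → MvPolynomial (Fin N) ℂ)
    (hinj : Function.Injective (aeval F : MvPolynomial (Fin N) ℂ →ₐ[ℂ] MvPolynomial (Fin N) ℂ))
    (hint : ((aeval F : MvPolynomial (Fin N) ℂ →ₐ[ℂ] MvPolynomial (Fin N) ℂ) : MvPolynomial (Fin N) ℂ →+* MvPolynomial (Fin N) ℂ).IsIntegral)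
    (a : Fin N → MvPolynomial (Fin N) ℂ) (ha : ∀ j, der a (F j) = 0) : a = 0 := by
  classical
  funext i
  let Φ : MvPolynomial (Fin N) ℂ →+* MvPolynomial (Fin N) ℂ := (aeval F : MvPolynomial (Fin N) ℂ →ₐ[ℂ] MvPolynomial (Fin N) ℂ)
  have hΦ : ∀ p, der a (Φ p) = 0 := by
    intro p
    have := chain (der a) F p
    simp only [ha, mul_zero, Finset.sum_const_zero] at this
    exact this
  have hev : ∀ P : Polynomial (MvPolynomial (Fin N) ℂ), der a (P.eval₂ Φ (X i)) = P.derivative.eval₂ Φ (X i) * a i := by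
    intro P
    induction P using Polynomial.induction_on' with
    | add p q hp hq => simp only [Polynomial.eval₂_add, map_add, hp, hq, add_mul]
    | monomial n c =>
      rw [Polynomial.derivative_monomial, Polynomial.eval₂_monomial, Polynomial.eval₂_monomial,
        Derivation.leibniz, hΦ, Derivation.leibniz_pow, smul_zero, add_zero]
      rw [show der a (X i) = a i from mkDerivation_X _ _ _]
      simp only [smul_eq_mul, nsmul_eq_mul, map_mul, map_natCast]
      ring
  have hex : ∃ n : ℕ, ∃ P : Polynomial (MvPolynomial (Fin N) ℂ), P ≠ 0 ∧ P.eval₂ Φ (X i) = 0 ∧ P.natDegree = n := by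
    obtain ⟨P, hP, hP2⟩ := hint (X i)
    exact ⟨_, P, hP.ne_zero, hP2, rfl⟩
  obtain ⟨P, hP0, hPe, hPn⟩ := Nat.find_spec hex
  have h1 := hev P
  rw [hPe, map_zero] at h1
  have hdeg : P.natDegree ≠ 0 := by
    intro h0
    rw [Polynomial.eq_C_of_natDegree_eq_zero h0, Polynomial.eval₂_C] at hPe
    have : P.coeff 0 = 0 := hinj (by rw [map_zero]; exact hPe)
    apply hP0
    rw [Polynomial.eq_C_of_natDegree_eq_zero h0, this, Polynomial.C_0]
  have h2 : P.derivative ≠ 0 := by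
    intro h0
    exact hdeg (Polynomial.derivative_eq_zero.mp h0)
  have h3 : P.derivative.eval₂ Φ (X i) ≠ 0 := by
    intro h0
    exact Nat.find_min hex (m := P.derivative.natDegree)
      (by rw [← hPn]; exact Polynomial.natDegree_derivative_lt hdeg) ⟨_, h2, h0, rfl⟩
  rcases mul_eq_zero.mp h1.symm with h | h
  · exact absurd h h3
  · exact h

/-- first order relations -/
def AR {N : ℕ} (h : MvPolynomial (Fin N) ℂ) (a : Fin N → MvPolynomial (Fin N) ℂ) : Prop :=
  ∑ i, a i * pderiv i h = 0

theorem dF_AR {N q : ℕ} (F : Fin N → MvPolynomial (Fin N) ℂ) (h : MvPolynomial (Fin N) ℂ) (lam : ℂ)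
    (hinv : aeval F h = C lam * h ^ q) (a : Fin N → MvPolynomial (Fin N) ℂ) (ha : AR h a) :
    ∑ i, der a (F i) * aeval F (pderiv i h) = 0 := by
  have h1 := chain (der a) F h
  have h2 : der a h = 0 := by rw [der_apply]; exact ha
  rw [hinv, ← smul_eq_C_mul, Derivation.map_smul, Derivation.leibniz_pow, h2, smul_zero, smul_zero, smul_zero] at h1
  rw [h1]
  exact Finset.sum_congr rfl fun i _ => mul_comm _ _

theorem star {N q : ℕ} (F : Fin N → MvPolynomial (Fin N) ℂ)
    (hF : ∀ i, (F i).IsHomogeneous q)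
    (h : MvPolynomial (Fin N) ℂ) (lam : ℂ)
    (hinv : aeval F h = C lam * h ^ q) {κ : Type} [Fintype κ] (e : κ → MvPolynomial (Fin N) ℂ)
    (gen : ∀ D s, s.totalDegree ≤ D → ∃ p : κ → MvPolynomial (Fin N) ℂ,
        s = ∑ j, e j * aeval F (p j) ∧ ∀ j, q * (p j).totalDegree ≤ D)
    (ind : ∀ p : κ → MvPolynomial (Fin N) ℂ, ∑ j, e j * aeval F (p j) = 0 → p = 0)
    (a : Fin N → MvPolynomial (Fin N) ℂ) (ha : AR h a) (r : ℕ) (hr : ∀ i, (a i).totalDegree ≤ r) :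
    ∃ p : κ → Fin N → MvPolynomial (Fin N) ℂ, (∀ j, AR h (p j)) ∧
      (∀ j i, q * (p j i).totalDegree ≤ r + (q - 1)) ∧
      ∀ i, der a (F i) = ∑ j, e j * aeval F (p j i) := by
  have hdeg : ∀ i, (der a (F i)).totalDegree ≤ r + (q - 1) := by
    intro i
    rw [der_apply]
    refine totalDegree_finsetSum_le fun k _ => (totalDegree_mul _ _).trans ?_
    exact add_le_add (hr k) (hF i).pderiv.totalDegree_le
  choose p hp hp2 using fun i => gen _ _ (hdeg i)
  refine ⟨fun j i => p i j, ?_, fun j i => hp2 i j, hp⟩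
  have h1 := dF_AR F h lam hinv a ha
  have h2 := ind (fun j => ∑ i, p i j * pderiv i h) (by
    rw [← h1]
    simp only [map_sum, map_mul, Finset.mul_sum]
    rw [Finset.sum_comm]
    refine Finset.sum_congr rfl fun i _ => ?_
    rw [hp i, Finset.sum_mul]
    exact Finset.sum_congr rfl fun j _ => by ring)
  exact fun j => congrFun h2 j

end TI

namespace TI

theorem span_semi {N : ℕ} {K : Type*} [Field K] (φ : K →+* K) (Y : Set (Fin N → K)) (v : Fin N → K)
    (hv : v ∈ Submodule.span K Y) :
    (fun i => φ (v i)) ∈ Submodule.span K ((fun (w : Fin N → K) i => φ (w i)) '' Y) := by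
  induction hv using Submodule.span_induction with
  | mem x hx => exact Submodule.subset_span ⟨x, hx, rfl⟩
  | zero =>
    have : (fun i => φ ((0 : Fin N → K) i)) = 0 := by funext i; simp
    rw [this]; exact Submodule.zero_mem _
  | add x y _ _ hx hy =>
    have : (fun i => φ ((x + y) i)) = (fun i => φ (x i)) + fun i => φ (y i) := by
      funext i; simp
    rw [this]; exact Submodule.add_mem _ hx hy
  | smul c x _ hx =>
    have : (fun i => φ ((c • x) i)) = φ c • (fun i => φ (x i)) := by
      funext i; simp
    rw [this]; exact Submodule.smul_mem _ _ hx

theorem span_semi_finrank {N : ℕ} {K : Type*} [Field K] (φ : K →+* K) (Y : Set (Fin N → K)) :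
    Module.finrank K (Submodule.span K ((fun (w : Fin N → K) i => φ (w i)) '' Y)) ≤
      Module.finrank K (Submodule.span K Y) := by
  obtain ⟨κ, a, ha, hspan, hli⟩ := exists_linearIndependent' K (fun y : Y => (y : Fin N → K))
  have := hli.finite
  have := Fintype.ofFinite κ
  rw [Subtype.range_coe] at hspan
  rw [← hspan, finrank_span_eq_card hli]
  refine le_trans (Submodule.finrank_mono (t := Submodule.span K (Set.range
    (fun k i => φ ((a k : Fin N → K) i)))) ?_) (finrank_range_le_card _)
  rw [Submodule.span_le]
  rintro _ ⟨y, hy, rfl⟩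
  have h1 : y ∈ Submodule.span K (Set.range ((fun y : Y => (y : Fin N → K)) ∘ a)) := by
    rw [hspan]; exact Submodule.subset_span hy
  have h2 := span_semi φ _ _ h1
  rw [← Set.range_comp] at h2
  exact h2

theorem rank {n q : ℕ} (hq : 2 ≤ q) (F : Fin (n + 1) → MvPolynomial (Fin (n + 1)) ℂ)
    (hF : ∀ i, (F i).IsHomogeneous q)
    (hF0 : ∀ x : Fin (n + 1) → ℂ, (∀ i, eval x (F i) = 0) → x = 0)
    (h : MvPolynomial (Fin (n + 1)) ℂ) (lam : ℂ)
    (hinv : aeval F h = C lam * h ^ q) (d : ℕ) (hh : h.IsHomogeneous d) :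
    ∃ A : Fin n → Fin (n + 1) → MvPolynomial (Fin (n + 1)) ℂ,
      (∀ k i, (A k i).IsHomogeneous 1) ∧ (∀ k, AR h (A k)) ∧
      ∀ c : Fin n → MvPolynomial (Fin (n + 1)) ℂ, (∀ i, ∑ k, c k * A k i = 0) → c = 0 := by
  classical
  obtain ⟨κ, _, e, gen, ind⟩ := freeness (by omega : 0 < q) F hF hF0
  have hinj : Function.Injective (aeval F : MvPolynomial (Fin (n + 1)) ℂ →ₐ[ℂ] MvPolynomial (Fin (n + 1)) ℂ) := by
    rw [injective_iff_map_eq_zero]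
    intro p hp
    have hne : Nonempty κ := by
      by_contra hcon
      rw [not_nonempty_iff] at hcon
      obtain ⟨p, hp, -⟩ := gen _ (1 : MvPolynomial (Fin (n + 1)) ℂ) le_rfl
      simp at hp
    obtain ⟨j0⟩ := hne
    have := ind (fun j => p) (Finset.sum_eq_zero fun j _ => by rw [hp, mul_zero])
    exact congrFun this j0
  have hint : ((aeval F : MvPolynomial (Fin (n + 1)) ℂ →ₐ[ℂ] MvPolynomial (Fin (n + 1)) ℂ) : MvPolynomial (Fin (n + 1)) ℂ →+* MvPolynomial (Fin (n + 1)) ℂ).IsIntegral := by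
    apply RingHom.Finite.to_isIntegral
    unfold RingHom.Finite
    let alg : Algebra (MvPolynomial (Fin (n + 1)) ℂ) (MvPolynomial (Fin (n + 1)) ℂ) :=
      ((aeval F : MvPolynomial (Fin (n + 1)) ℂ →ₐ[ℂ] MvPolynomial (Fin (n + 1)) ℂ) : MvPolynomial (Fin (n + 1)) ℂ →+* MvPolynomial (Fin (n + 1)) ℂ).toAlgebra
    refine @Module.Finite.of_fg_top _ _ _ _ alg.toModule ⟨Finset.univ.image e, ?_⟩
    rw [eq_top_iff]
    intro s _
    obtain ⟨p, hp, -⟩ := gen _ s le_rfl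
    rw [hp]
    refine sum_mem fun j _ => ?_
    have h1 : e j * aeval F (p j) = @HSMul.hSMul _ _ _ (@instHSMul _ _ alg.toSMul) (p j) (e j) := mul_comm _ _
    rw [h1]
    exact @Submodule.smul_mem _ _ _ _ alg.toModule _ _ _ (@Submodule.subset_span _ _ _ _ alg.toModule _ _ (by simp))
  let K := FractionRing (MvPolynomial (Fin (n + 1)) ℂ)
  let ι : MvPolynomial (Fin (n + 1)) ℂ →+* K := algebraMap _ _
  have hι : Function.Injective ι := IsFractionRing.injective _ _
  let Φ : MvPolynomial (Fin (n + 1)) ℂ →+* MvPolynomial (Fin (n + 1)) ℂ := (aeval F : MvPolynomial (Fin (n + 1)) ℂ →ₐ[ℂ] MvPolynomial (Fin (n + 1)) ℂ)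
  have hΦι : Function.Injective (ι.comp Φ) := hι.comp hinj
  let φ : K →+* K := IsFractionRing.lift hΦι
  have hφ : ∀ x, φ (ι x) = ι (aeval F x) := fun x => IsFractionRing.lift_algebraMap hΦι x
  let vι : (Fin (n + 1) → MvPolynomial (Fin (n + 1)) ℂ) → Fin (n + 1) → K := fun a i => ι (a i)
  let L1 : Set (Fin (n + 1) → MvPolynomial (Fin (n + 1)) ℂ) := {a | AR h a ∧ ∀ i, (a i).IsHomogeneous 1}
  let Y := vι '' L1
  let W := Submodule.span K Y
  let W' := Submodule.span K ((fun (w : Fin (n + 1) → K) i => φ (w i)) '' Y)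
  let J : Matrix (Fin (n + 1)) (Fin (n + 1)) (MvPolynomial (Fin (n + 1)) ℂ) := Matrix.of fun i j => pderiv j (F i)
  have hJ : ∀ a i, J.mulVec a i = der a (F i) := by
    intro a i
    rw [der_apply]
    simp only [Matrix.mulVec, dotProduct]
    exact Finset.sum_congr rfl fun j _ => mul_comm _ _
  have hdet : J.det ≠ 0 := by
    intro h0
    rw [← Matrix.exists_mulVec_eq_zero_iff] at h0
    obtain ⟨v, hv, hv2⟩ := h0
    exact hv (dF_inj F hinj hint v fun j => by rw [← hJ, hv2]; rfl)
  let JK : (Fin (n + 1) → K) →ₗ[K] (Fin (n + 1) → K) := (J.map ι).mulVecLin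
  have hJK : Function.Injective JK := by
    rw [injective_iff_map_eq_zero]
    intro v hv
    by_contra hne
    have h1 : (J.map ι).det = 0 := Matrix.exists_mulVec_eq_zero_iff.mp ⟨v, hne, hv⟩
    rw [← RingHom.mapMatrix_apply, ← RingHom.map_det] at h1
    exact hdet (hι (by rw [h1, map_zero]))
  have hJKι : ∀ a, JK (vι a) = fun i => ι (der a (F i)) := by
    intro a
    funext i
    rw [← hJ]
    change (J.map ι).mulVec (ι ∘ a) i = _
    rw [RingHom.map_mulVec]
  -- degree at most one
  have hL : ∀ a, AR h a → (∀ i, (a i).totalDegree ≤ 1) → vι a ∈ W := by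
    intro a ha hdeg
    have hdec : ∀ i, a i = homogeneousComponent 0 (a i) + homogeneousComponent 1 (a i) := by
      intro i
      conv_lhs => rw [← sum_homogeneousComponent (a i)]
      rw [Finset.sum_subset (s₂ := Finset.range 2)]
      · simp [Finset.sum_range_succ]
      · intro x hx; simp only [Finset.mem_range] at *; have := hdeg i; omega
      · intro x _ hx; simp only [Finset.mem_range] at hx
        exact homogeneousComponent_eq_zero _ _ (by omega)
    have hcomp : ∀ r, AR h fun i => homogeneousComponent r (a i) := by
      intro r
      have := congrArg (homogeneousComponent (r + (d - 1))) ha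
      rw [map_sum, map_zero] at this
      unfold AR
      rw [← this]
      refine Finset.sum_congr rfl fun i _ => ?_
      rw [hc_mul (d - 1) _ _ _ hh.pderiv, if_pos (by omega), Nat.add_sub_cancel]
    have h1 : vι (fun i => homogeneousComponent 1 (a i)) ∈ W :=
      Submodule.subset_span ⟨_, ⟨hcomp 1, fun i => homogeneousComponent_isHomogeneous _ _⟩, rfl⟩
    have h0 : vι (fun i => X 0 * homogeneousComponent 0 (a i)) ∈ W := by
      refine Submodule.subset_span ⟨_, ⟨?_, fun i => ?_⟩, rfl⟩
      · have := hcomp 0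
        unfold AR at this ⊢
        simp_rw [mul_assoc]
        rw [← Finset.mul_sum, this, mul_zero]
      · exact (isHomogeneous_X ℂ (0 : Fin (n + 1))).mul (homogeneousComponent_isHomogeneous 0 (a i))
    have hX : ι (X 0) ≠ 0 := by
      intro h0
      exact X_ne_zero (R := ℂ) (0 : Fin (n + 1)) (hι (by rw [h0, map_zero]))
    have : vι a = (ι (X 0))⁻¹ • vι (fun i => X 0 * homogeneousComponent 0 (a i)) +
        vι (fun i => homogeneousComponent 1 (a i)) := by
      funext i
      change ι (a i) = (ι (X 0))⁻¹ * ι (X 0 * homogeneousComponent 0 (a i)) + ι (homogeneousComponent 1 (a i))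
      rw [map_mul, inv_mul_cancel_left₀ hX, ← map_add, ← hdec]
    rw [this]
    exact Submodule.add_mem _ (Submodule.smul_mem _ _ h0) h1
  have hcomb : ∀ p : κ → Fin (n + 1) → MvPolynomial (Fin (n + 1)) ℂ, (∀ j, vι (p j) ∈ W) →
      (fun i => ι (∑ j, e j * aeval F (p j i))) ∈ W' := by
    intro p hp
    have : (fun i => ι (∑ j, e j * aeval F (p j i))) = ∑ j, ι (e j) • fun i => φ (vι (p j) i) := by
      funext i
      rw [Finset.sum_apply, map_sum]
      refine Finset.sum_congr rfl fun j _ => ?_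
      rw [map_mul, ← hφ]; rfl
    rw [this]
    exact Submodule.sum_mem _ fun j _ => Submodule.smul_mem _ _ (span_semi φ _ _ (hp j))
  have hle : W.map JK ≤ W' := by
    rw [Submodule.map_span_le]
    rintro _ ⟨a, ⟨ha, hdeg⟩, rfl⟩
    obtain ⟨p, hp1, hp2, hp3⟩ := star F hF h lam hinv e gen ind a ha 1 fun i => (hdeg i).totalDegree_le
    rw [hJKι]
    simp_rw [hp3]
    refine hcomb p fun j => hL _ (hp1 j) fun i => ?_
    have := hp2 j i
    by_contra hcon
    have : q * 2 ≤ q * (p j i).totalDegree := Nat.mul_le_mul_left _ (by omega)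
    omega
  have heq : W.map JK = W' := by
    apply Submodule.eq_of_le_of_finrank_le hle
    rw [(Submodule.equivMapOfInjective JK hJK W).symm.finrank_eq]
    exact span_semi_finrank φ Y
  have hall : ∀ r a, AR h a → (∀ i, (a i).totalDegree ≤ r) → vι a ∈ W := by
    intro r
    induction r using Nat.strong_induction_on with
    | _ r ih =>
    intro a ha hdeg
    by_cases hr : r ≤ 1
    · exact hL a ha fun i => (hdeg i).trans hr
    · obtain ⟨p, hp1, hp2, hp3⟩ := star F hF h lam hinv e gen ind a ha r hdeg
      have h1 : JK (vι a) ∈ W' := by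
        rw [hJKι]
        simp_rw [hp3]
        refine hcomb p fun j => ih (r - 1) (by omega) _ (hp1 j) fun i => ?_
        have := hp2 j i
        by_contra hcon
        have h5 : q * r ≤ q * (p j i).totalDegree := Nat.mul_le_mul_left _ (by omega)
        obtain ⟨q', rfl⟩ : ∃ q', q = q' + 2 := ⟨q - 2, by omega⟩
        obtain ⟨r', rfl⟩ : ∃ r', r = r' + 2 := ⟨r - 2, by omega⟩
        have h6 : q' + 2 - 1 = q' + 1 := by omega
        rw [h6] at this
        nlinarith
      rw [← heq] at h1
      obtain ⟨w, hw, hw2⟩ := h1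
      rwa [← hJK hw2]
  -- dimension
  let ev : (Fin (n + 1) → K) →ₗ[K] K := ∑ i, (ι (pderiv i h)) • LinearMap.proj i
  have hev : ∀ v, ev v = ∑ i, ι (pderiv i h) * v i := by
    intro v; simp [ev]
  have hker : LinearMap.ker ev ≤ W := by
    intro v hv
    rw [LinearMap.mem_ker, hev] at hv
    obtain ⟨b, hb⟩ := IsLocalization.exist_integer_multiples_of_finite
      (nonZeroDivisors (MvPolynomial (Fin (n + 1)) ℂ)) v
    choose a ha using hb
    have hb0 : ι b ≠ 0 := by
      intro h0
      exact nonZeroDivisors.ne_zero b.2 (hι (by rw [h0, map_zero]))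
    have ha' : ∀ i, ι (a i) = ι b * v i := fun i => by
      have := ha i
      rw [Algebra.smul_def] at this; exact this
    have h1 : vι a ∈ W := by
      refine hall (∑ i, (a i).totalDegree) a ?_ fun i => Finset.single_le_sum (f := fun i => (a i).totalDegree) (fun _ _ => Nat.zero_le _) (Finset.mem_univ i)
      apply hι
      rw [map_zero, map_sum]
      have : ∑ i, ι (a i * pderiv i h) = ι b * ∑ i, ι (pderiv i h) * v i := by
        rw [Finset.mul_sum]
        refine Finset.sum_congr rfl fun i _ => ?_
        rw [map_mul, ha']; ring
      rw [this, hv, mul_zero]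
    have h2 : v = (ι b)⁻¹ • vι a := by
      funext i
      change v i = (ι b)⁻¹ * ι (a i)
      rw [ha', inv_mul_cancel_left₀ hb0]
    rw [h2]
    exact Submodule.smul_mem _ _ h1
  have hrank : n ≤ Module.finrank K W := by
    have h1 := LinearMap.finrank_range_add_finrank_ker ev
    have h2 : Module.finrank K (LinearMap.range ev) ≤ 1 := by
      refine (Submodule.finrank_le _).trans ?_
      rw [Module.finrank_self]
    rw [Module.finrank_fintype_fun_eq_card, Fintype.card_fin] at h1
    have h3 := Submodule.finrank_mono hker
    omega
  obtain ⟨κ', a, ha, hspan, hli⟩ := exists_linearIndependent' K (fun y : L1 => vι y)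
  have := hli.finite
  have := Fintype.ofFinite κ'
  have hrange : Set.range (fun y : L1 => vι y) = Y := by
    ext v; simp [Y]
  rw [hrange] at hspan
  have hcard : n ≤ Fintype.card κ' := by
    rw [← finrank_span_eq_card hli, hspan]; exact hrank
  let g : Fin n → κ' := fun k => (Fintype.equivFin κ').symm (Fin.castLE hcard k)
  have hg : Function.Injective g := (Fintype.equivFin κ').symm.injective.comp (Fin.castLE_injective hcard)
  refine ⟨fun k => (a (g k) : Fin (n + 1) → MvPolynomial (Fin (n + 1)) ℂ), fun k i => (a (g k)).2.2 i, fun k => (a (g k)).2.1, ?_⟩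
  intro c hc
  have h1 := Fintype.linearIndependent_iff.mp (hli.comp g hg) (fun k => ι (c k)) (by
    funext i
    rw [Finset.sum_apply]
    have := congrArg ι (hc i)
    rw [map_sum, map_zero] at this
    rw [Pi.zero_apply, ← this]
    refine Finset.sum_congr rfl fun k _ => ?_
    rw [map_mul]; rfl)
  funext k
  exact hι (by rw [h1 k, Pi.zero_apply, map_zero])

end TI

namespace TI

/-- chains of primes over `I` have length at most `k` -/
def Dle {N : ℕ} (I : Ideal (MvPolynomial (Fin N) ℂ)) (k : ℕ) : Prop :=
  ∀ l : LTSeries (PrimeSpectrum.zeroLocus (I : Set (MvPolynomial (Fin N) ℂ))), l.length ≤ k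

theorem Dle_of_dim {N : ℕ} (I : Ideal (MvPolynomial (Fin N) ℂ)) (k : ℕ)
    (h : ringKrullDim (MvPolynomial (Fin N) ℂ ⧸ I) ≤ k) : Dle I k := by
  intro l
  rw [ringKrullDim_quotient] at h
  have := (Order.LTSeries.length_le_krullDim l).trans h
  exact_mod_cast this

theorem Dle_drop {N : ℕ} (I : Ideal (MvPolynomial (Fin N) ℂ)) (k : ℕ) (h : Dle I (k + 1))
    (G : MvPolynomial (Fin N) ℂ) (hG : ∀ p ∈ I.minimalPrimes, G ∉ p) : Dle (I ⊔ Ideal.span {G}) k := by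
  intro l
  have hsub : ∀ x : PrimeSpectrum (MvPolynomial (Fin N) ℂ),
      x ∈ PrimeSpectrum.zeroLocus ((I ⊔ Ideal.span {G} : Ideal _) : Set (MvPolynomial (Fin N) ℂ)) →
      x ∈ PrimeSpectrum.zeroLocus (I : Set (MvPolynomial (Fin N) ℂ)) := by
    intro x hx y hy
    exact hx (Ideal.mem_sup_left hy)
  let l' : LTSeries (PrimeSpectrum.zeroLocus (I : Set (MvPolynomial (Fin N) ℂ))) :=
    l.map (fun x => ⟨x.1, hsub x.1 x.2⟩) (fun _ _ h => h)
  have hle : I ≤ l.head.1.asIdeal := fun y hy => l.head.2 (Ideal.mem_sup_left hy)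
  obtain ⟨r, hrm, hr⟩ := Ideal.exists_minimalPrimes_le hle
  let r' : PrimeSpectrum.zeroLocus (I : Set (MvPolynomial (Fin N) ℂ)) :=
    ⟨⟨r, hrm.1.1⟩, hrm.1.2⟩
  have hlt : r' < l'.head := by
    refine lt_of_le_of_ne ?_ ?_
    · exact hr
    · intro h0
      have h1 : r = l.head.1.asIdeal := congrArg (fun x => x.1.asIdeal) h0
      apply hG r hrm
      rw [h1]
      exact l.head.2 (Ideal.mem_sup_right (Ideal.subset_span rfl))
  have := h (l'.cons r' hlt)
  have h2 : (l'.cons r' hlt).length = l.length + 1 := by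
    rw [RelSeries.cons_length]; rfl
  omega

/-- restriction to the line through p -/
noncomputable def θ {N : ℕ} (p : Fin N → ℂ) : MvPolynomial (Fin N) ℂ →ₐ[ℂ] Polynomial ℂ :=
  aeval fun i => Polynomial.C (p i) * Polynomial.X

theorem θ_hom {N : ℕ} (p : Fin N → ℂ) (g : MvPolynomial (Fin N) ℂ) (e : ℕ) (hg : g.IsHomogeneous e) :
    θ p g = Polynomial.C (eval p g) * Polynomial.X ^ e := by
  rw [θ, aeval_def, eval₂_eq', eval_eq', map_sum, Finset.sum_mul]
  refine Finset.sum_congr rfl fun d hd => ?_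
  have h1 : ∑ i, d i = e := by
    have := hg (mem_support_iff.mp hd)
    rw [← this, Finsupp.weight_apply, Finsupp.sum_fintype _ _ (by simp)]
    simp
  simp only [mul_pow, Finset.prod_mul_distrib, map_mul, map_prod, map_pow, Finset.prod_pow_eq_pow_sum, h1]
  rw [Polynomial.algebraMap_eq]; ring

theorem mem_of_X {N : ℕ} (P : Ideal (MvPolynomial (Fin N) ℂ)) (hP : ∀ i, X i ∈ P)
    (g : MvPolynomial (Fin N) ℂ) : g - C (constantCoeff g) ∈ P := by
  induction g using MvPolynomial.induction_on with
  | C a => simp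
  | add p q hp hq =>
    have : p + q - C (constantCoeff (p + q)) = (p - C (constantCoeff p)) + (q - C (constantCoeff q)) := by
      simp only [map_add]; ring
    rw [this]; exact P.add_mem hp hq
  | mul_X p i _ =>
    simp only [map_mul, constantCoeff_X, mul_zero, map_zero, sub_zero]
    exact P.mul_mem_left _ (hP i)

theorem θ_const {N : ℕ} (p : Fin N → ℂ) (g : MvPolynomial (Fin N) ℂ) :
    (θ p g).eval 0 = constantCoeff g := by
  induction g using MvPolynomial.induction_on with
  | C a => simp [θ, algHom_C]
  | add p q hp hq => simp [hp, hq]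
  | mul_X p i _ => simp [θ]

theorem lineIdeal_le {N : ℕ} (p : Fin N → ℂ) (P : Ideal (MvPolynomial (Fin N) ℂ)) (hP : ∀ i, X i ∈ P) :
    RingHom.ker (θ p) ≤ P := by
  intro g hg
  rw [RingHom.mem_ker] at hg
  have h1 := θ_const p g
  rw [hg, Polynomial.eval_zero] at h1
  have := mem_of_X P hP g
  rwa [← h1, C_0, sub_zero] at this

theorem X_notMem_line {N : ℕ} (p : Fin N → ℂ) (i : Fin N) (hi : p i ≠ 0) : X i ∉ RingHom.ker (θ p) := by
  rw [RingHom.mem_ker]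
  simp [θ, hi]

theorem not_Dle_zero {N : ℕ} (I : Ideal (MvPolynomial (Fin N) ℂ)) (p : Fin N → ℂ) (hp : p ≠ 0)
    (hI : I ≤ RingHom.ker (θ p)) : ¬ Dle I 0 := by
  intro h
  have hX : ∀ i, X i ∈ RingHom.ker (constantCoeff (R := ℂ) (σ := Fin N)) := by
    intro i; rw [RingHom.mem_ker]; simp
  have hle := lineIdeal_le p _ hX
  obtain ⟨i, hi⟩ := Function.ne_iff.mp hp
  let m : PrimeSpectrum.zeroLocus (I : Set (MvPolynomial (Fin N) ℂ)) :=
    ⟨⟨_, RingHom.ker_isPrime (constantCoeff (R := ℂ) (σ := Fin N))⟩, fun y hy => hle (hI hy)⟩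
  let Q : PrimeSpectrum.zeroLocus (I : Set (MvPolynomial (Fin N) ℂ)) :=
    ⟨⟨_, RingHom.ker_isPrime (θ p)⟩, hI⟩
  have hlt : Q < m := by
    refine lt_of_le_of_ne hle fun h0 => ?_
    have h1 : RingHom.ker (θ p) = RingHom.ker (constantCoeff (R := ℂ) (σ := Fin N)) :=
      congrArg (fun x => x.1.asIdeal) h0
    apply X_notMem_line p i hi
    rw [h1]; exact hX i
  let l : LTSeries (PrimeSpectrum.zeroLocus (I : Set (MvPolynomial (Fin N) ℂ))) :=
    RelSeries.singleton _ m
  have hlt' : Q < l.head := hlt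
  have := h (RelSeries.cons l Q hlt')
  have h2 : (RelSeries.cons l Q hlt').length = 1 := by
    simp [l, RelSeries.cons_length]
  omega

theorem linear_cut {N : ℕ} (d : ℕ) (V : Submodule ℂ (MvPolynomial (Fin N) ℂ)) (hV : ∀ v ∈ V, v.IsHomogeneous d)
    (m : ℕ) (hm : m ≤ N)
    (hdim : Dle (Ideal.span (V : Set (MvPolynomial (Fin N) ℂ))) m) :
    ∀ k ≤ m, ∃ f : Fin N → MvPolynomial (Fin N) ℂ, H1 Finset.univ f ∧ (∀ i, (f i).IsHomogeneous 1) ∧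
      (∀ i : Fin N, k ≤ i → f i = X i) ∧
      ((∀ p : Fin N → ℂ, (∀ g ∈ Ideal.span (V : Set (MvPolynomial (Fin N) ℂ)) ⊔ Ideal.span (f '' {i : Fin N | (i : ℕ) < k}),
          eval p g = 0) → p = 0) ∨
        Dle (Ideal.span (V : Set (MvPolynomial (Fin N) ℂ)) ⊔ Ideal.span (f '' {i : Fin N | (i : ℕ) < k})) (m - k)) := by
  intro k
  induction k with
  | zero =>
    intro _
    refine ⟨X, H1_X, fun i => isHomogeneous_X _ _, fun _ _ => rfl, Or.inr ?_⟩
    simpa using hdim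
  | succ k ih =>
    intro hk
    obtain ⟨f, h1, h2, h3, h4⟩ := ih (by omega)
    obtain ⟨I, hI⟩ : ∃ I, I = Ideal.span (V : Set (MvPolynomial (Fin N) ℂ)) ⊔ Ideal.span (f '' {i : Fin N | (i : ℕ) < k}) := ⟨_, rfl⟩
    rw [← hI] at h4
    by_cases hz : ∀ p : Fin N → ℂ, (∀ g ∈ I, eval p g = 0) → p = 0
    · refine ⟨f, h1, h2, fun i hi => h3 i (by omega), Or.inl fun p hp => hz p fun g hg => hp g ?_⟩
      have hle : I ≤ Ideal.span (V : Set (MvPolynomial (Fin N) ℂ)) ⊔ Ideal.span (f '' {i : Fin N | (i : ℕ) < k + 1}) := by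
        rw [hI]
        refine sup_le_sup_left (Ideal.span_mono (Set.image_mono fun i hi => ?_)) _
        exact Nat.lt_succ_of_lt hi
      exact hle hg
    · have hD : Dle I (m - k) := h4.resolve_left hz
      push Not at hz
      obtain ⟨p, hp, hp0⟩ := hz
      have hIQ : I ≤ RingHom.ker (θ p) := by
        rw [hI]
        refine sup_le ?_ ?_
        · rw [Ideal.span_le]
          intro v hv
          have : eval p v = 0 := hp v (by rw [hI]; exact Ideal.mem_sup_left (Ideal.subset_span hv))
          change θ p v = 0
          rw [θ_hom p v d (hV v hv), this]; simp
        · rw [Ideal.span_le]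
          rintro _ ⟨i, hi, rfl⟩
          have : eval p (f i) = 0 := hp _ (by rw [hI]; exact Ideal.mem_sup_right (Ideal.subset_span ⟨i, hi, rfl⟩))
          change θ p (f i) = 0
          rw [θ_hom p _ 1 (h2 i), this]; simp
      let k' : Fin N := ⟨k, by omega⟩
      obtain ⟨G, hG, hG2, hG3⟩ := exchange (f := f) (fun _ => 1) h2 (fun _ => one_pos) h1 k'
        (homogeneousSubmodule (Fin N) ℂ 1) 1 (by
          rw [pow_one]
          exact Ideal.mem_sup_left (Ideal.subset_span (h2 k'))) I.minimalPrimes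
          (Ideal.finite_minimalPrimes_of_isNoetherianRing _ I) (by
          intro P hP hcon
          have hX : ∀ i, X i ∈ P := fun i => hcon _ (isHomogeneous_X _ i)
          have hle := lineIdeal_le p P hX
          have := hP.2 ⟨RingHom.ker_isPrime (θ p), hIQ⟩ hle
          obtain ⟨i, hi⟩ := Function.ne_iff.mp hp0
          exact X_notMem_line p i hi (this (hX i)))
      refine ⟨_, hG2, ?_, ?_, Or.inr ?_⟩
      · intro i
        by_cases hik : i = k'
        · subst hik; rw [Function.update_self]; exact hG
        · rw [Function.update_of_ne hik]; exact h2 i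
      · intro i hi
        rw [Function.update_of_ne (by rintro rfl; simp only [k'] at hi; omega)]
        exact h3 i (by omega)
      · have heq : Ideal.span (V : Set (MvPolynomial (Fin N) ℂ)) ⊔
            Ideal.span (Function.update f k' G '' {i : Fin N | (i : ℕ) < k + 1}) = I ⊔ Ideal.span {G} := by
          have hset : Function.update f k' G '' {i : Fin N | (i : ℕ) < k + 1} =
              f '' {i : Fin N | (i : ℕ) < k} ∪ {G} := by
            ext g
            constructor
            · rintro ⟨i, hi, rfl⟩
              by_cases hik : i = k'
              · right; rw [hik, Function.update_self]; rfl
              · left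
                rw [Function.update_of_ne hik]
                refine ⟨i, ?_, rfl⟩
                have h5 : (i : ℕ) ≠ k := fun h => hik (Fin.ext h)
                change (i : ℕ) < k + 1 at hi
                change (i : ℕ) < k
                omega
            · rintro (⟨i, hi, rfl⟩ | rfl)
              · refine ⟨i, Nat.lt_succ_of_lt hi, ?_⟩
                rw [Function.update_of_ne]
                rintro rfl
                exact lt_irrefl k hi
              · exact ⟨k', Nat.lt_succ_self k, Function.update_self _ _ _⟩
          rw [hset, Ideal.span_union, ← sup_assoc, ← hI]
        rw [heq]
        apply Dle_drop I _ _ G hG3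
        have : m - (k + 1) + 1 = m - k := by omega
        rwa [this]

theorem cut {N : ℕ} (d : ℕ) (hd : 0 < d) (V : Submodule ℂ (MvPolynomial (Fin N) ℂ)) (hV : ∀ v ∈ V, v.IsHomogeneous d)
    (m : ℕ) (hm : m ≤ N)
    (hdim : Dle (Ideal.span (V : Set (MvPolynomial (Fin N) ℂ))) m) :
    ∃ f : Fin N → MvPolynomial (Fin N) ℂ, H1 (Finset.univ.filter fun i : Fin N => m ≤ i) f ∧ ∀ i : Fin N, m ≤ i → f i ∈ V := by
  classical
  obtain ⟨f, h1, h2, -, h4⟩ := linear_cut d V hV m hm hdim m le_rfl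
  have hz : ∀ p : Fin N → ℂ, (∀ g ∈ Ideal.span (V : Set (MvPolynomial (Fin N) ℂ)) ⊔ Ideal.span (f '' {i : Fin N | (i : ℕ) < m}),
          eval p g = 0) → p = 0 := by
    rcases h4 with h4 | h4
    · exact h4
    · intro p hp
      by_contra hp0
      rw [Nat.sub_self] at h4
      refine not_Dle_zero _ p hp0 ?_ h4
      refine sup_le ?_ ?_
      · rw [Ideal.span_le]
        intro v hv
        have : eval p v = 0 := hp v (Ideal.mem_sup_left (Ideal.subset_span hv))
        change θ p v = 0
        rw [θ_hom p v d (hV v hv), this]; simp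
      · rw [Ideal.span_le]
        rintro _ ⟨i, hi, rfl⟩
        have : eval p (f i) = 0 := hp _ (Ideal.mem_sup_right (Ideal.subset_span ⟨i, hi, rfl⟩))
        change θ p (f i) = 0
        rw [θ_hom p _ 1 (h2 i), this]; simp
  let s : Finset (Fin N) := Finset.univ.filter fun i : Fin N => m ≤ i
  have hsc : (s : Set (Fin N))ᶜ = {i : Fin N | (i : ℕ) < m} := by ext i; simp [s]
  obtain ⟨f', g1, g2, g3⟩ := exchange_multi (fun _ => 1) h2 (fun _ => one_pos) h1 s d hd V hV (by
    intro i _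
    rw [hsc]
    have hX : ∀ i, X i ∈ (Ideal.span (V : Set (MvPolynomial (Fin N) ℂ)) ⊔ Ideal.span (f '' {i : Fin N | (i : ℕ) < m})).radical :=
      fun i => nullst _ hz i
    have := mem_of_X _ hX (f i)
    have h0 : constantCoeff (f i) = 0 := by
      rw [constantCoeff_eq]
      exact (h2 i).coeff_eq_zero (by simp)
    rw [h0, C_0, sub_zero] at this
    exact this)
  have g3' : ∀ i : Fin N, m ≤ i → f' i ∈ V := fun i hi => g3 i (by simp [s, hi])
  refine ⟨f', ?_, g3'⟩
  refine H1_subset (t := Finset.univ) (Finset.subset_univ _) (fun i => if i ∈ s then d else 1) ?_ ?_ g1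
  · intro i
    by_cases hi : i ∈ s
    · rw [if_pos hi]; exact hV _ (g3 i hi)
    · rw [if_neg hi, g2 i hi]; exact h2 i
  · intro i; split_ifs <;> omega

end TI

namespace TI

theorem syz_low {N : ℕ} {ι : Type*} [DecidableEq ι] [Fintype ι] (d e : ℕ) (hed : e < d)
    (v : ι → MvPolynomial (Fin N) ℂ) (hv : ∀ i, (v i).IsHomogeneous d) (H : H1 Finset.univ v)
    (a : ι → MvPolynomial (Fin N) ℂ) (ha : ∀ i, (a i).IsHomogeneous e) (h0 : ∑ i, a i * v i = 0) (i : ι) :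
    a i = 0 := by
  obtain ⟨c, -, hc⟩ := H a h0
  have h1 := hc i (Finset.mem_univ _)
  have h2 : homogeneousComponent e (a i) = a i := homogeneousComponent_of_mem (ha i) |>.trans (by simp)
  rw [← h2, h1, map_sum]
  refine Finset.sum_eq_zero fun j _ => ?_
  rw [hc_mul d e _ _ (hv j), if_neg (by omega), zero_mul]

theorem syz_eq {N : ℕ} {ι : Type*} [DecidableEq ι] [Fintype ι] (d : ℕ)
    (v : ι → MvPolynomial (Fin N) ℂ) (hv : ∀ i, (v i).IsHomogeneous d) (H : H1 Finset.univ v)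
    (a : ι → MvPolynomial (Fin N) ℂ) (ha : ∀ i, (a i).IsHomogeneous d) (h0 : ∑ i, a i * v i = 0) :
    ∃ c : ι → ι → ℂ, ∀ i, a i = ∑ j, C (c i j) * v j := by
  obtain ⟨c, -, hc⟩ := H a h0
  refine ⟨fun i j => coeff 0 (c i j), fun i => ?_⟩
  have h1 := hc i (Finset.mem_univ _)
  have h2 : homogeneousComponent d (a i) = a i := homogeneousComponent_of_mem (ha i) |>.trans (by simp)
  rw [← h2, h1, map_sum]
  refine Finset.sum_congr rfl fun j _ => ?_
  rw [hc_mul d d _ _ (hv j), if_pos le_rfl, Nat.sub_self, homogeneousComponent_zero]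

theorem core1 {N : ℕ} {ι : Type*} [DecidableEq ι] [Fintype ι]
    (v : ι → MvPolynomial (Fin N) ℂ) (hv : ∀ i, (v i).IsHomogeneous 2) (H : H1 Finset.univ v)
    (u : MvPolynomial (Fin N) ℂ) (p : Fin 4 → MvPolynomial (Fin N) ℂ) (b : Fin 4 → ι → MvPolynomial (Fin N) ℂ)
    (hp : ∀ k, (p k).IsHomogeneous 1) (hb : ∀ k i, (b k i).IsHomogeneous 1)
    (hs : ∀ k, ∑ i, b k i * v i = - (p k * u))
    (hind : ∀ c : Fin 4 → MvPolynomial (Fin N) ℂ, ∑ k, c k * p k = 0 → (∀ i, ∑ k, c k * b k i = 0) → c = 0) :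
    False := by
  have key : ∀ j k, ∃ c : ι → ι → ℂ, ∀ i, p j * b k i - p k * b j i = ∑ t, C (c i t) * v t := by
    intro j k
    refine syz_eq 2 v hv H _ (fun i => ((hp j).mul (hb k i)).sub ((hp k).mul (hb j i))) ?_
    simp only [sub_mul, Finset.sum_sub_distrib, mul_assoc, ← Finset.mul_sum, hs]
    ring
  choose c hc using key
  have hlin : ∀ x : Fin 4 → ℂ, ∑ k, C (x k) * p k = 0 → x = 0 := by
    intro x hx
    have := hind (fun k => C (x k)) hx (by
      refine syz_low 2 1 (by norm_num) v hv H _ (fun i => ?_) ?_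
      · refine IsHomogeneous.sum _ _ _ fun k _ => ?_
        simpa using (isHomogeneous_C (Fin N) (x k)).mul (hb k i)
      · simp only [Finset.sum_mul]
        rw [Finset.sum_comm]
        simp only [mul_assoc, ← Finset.mul_sum, hs]
        calc _ = - ((∑ k, C (x k) * p k) * u) := by
              rw [Finset.sum_mul, ← Finset.sum_neg_distrib]
              exact Finset.sum_congr rfl fun _ _ => by ring
          _ = 0 := by rw [hx]; simp)
    funext k
    have h1 := congrFun this k
    simpa using h1
  have hc0 : ∀ s t, c 0 1 s t = 0 := by
    intro s t
    have h1 : ∑ t, (p 0 * C (c 1 2 s t) + p 1 * C (c 2 0 s t) + p 2 * C (c 0 1 s t)) * v t = 0 := by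
      have e1 := hc 1 2 s
      have e2 := hc 2 0 s
      have e3 := hc 0 1 s
      simp only [add_mul, Finset.sum_add_distrib, mul_assoc, ← Finset.mul_sum]
      rw [← e1, ← e2, ← e3]; ring
    have h2 := syz_low 2 1 (by norm_num) v hv H _ (fun t => by
      refine ((?_ : IsHomogeneous _ 1).add (?_ : IsHomogeneous _ 1)).add (?_ : IsHomogeneous _ 1)
      · simpa using (hp 0).mul (isHomogeneous_C (Fin N) (c 1 2 s t))
      · simpa using (hp 1).mul (isHomogeneous_C (Fin N) (c 2 0 s t))
      · simpa using (hp 2).mul (isHomogeneous_C (Fin N) (c 0 1 s t))) h1 t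
    have h3 := hlin ![c 1 2 s t, c 2 0 s t, c 0 1 s t, 0] (by
      rw [← h2]; simp [Fin.sum_univ_succ]; ring)
    exact congrFun h3 2
  have h01 : ∀ i, p 0 * b 1 i - p 1 * b 0 i = 0 := by
    intro i; rw [hc]; simp [hc0]
  have h5 := hind ![-p 1, p 0, 0, 0] (by simp [Fin.sum_univ_succ]; ring) (fun i => by
    simp [Fin.sum_univ_succ]; linear_combination h01 i)
  have hp0 : p 0 = 0 := congrFun h5 1
  have h6 := hlin ![1, 0, 0, 0] (by simp [Fin.sum_univ_succ, hp0])
  have := congrFun h6 0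
  simp at this

theorem core2 {N : ℕ} {ι : Type*} [DecidableEq ι] [Fintype ι]
    (v : ι → MvPolynomial (Fin N) ℂ) (hv : ∀ i, (v i).IsHomogeneous 3) (H : H1 Finset.univ v)
    (u w : MvPolynomial (Fin N) ℂ) (p r : Fin 5 → MvPolynomial (Fin N) ℂ) (b : Fin 5 → ι → MvPolynomial (Fin N) ℂ)
    (hp : ∀ k, (p k).IsHomogeneous 1) (hr : ∀ k, (r k).IsHomogeneous 1) (hb : ∀ k i, (b k i).IsHomogeneous 1)
    (hs : ∀ k, ∑ i, b k i * v i = - (p k * u + r k * w))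
    (hind : ∀ c : Fin 5 → MvPolynomial (Fin N) ℂ, ∑ k, c k * p k = 0 → ∑ k, c k * r k = 0 →
      (∀ i, ∑ k, c k * b k i = 0) → c = 0) :
    False := by
  let Δ : Fin 5 → Fin 5 → MvPolynomial (Fin N) ℂ := fun j k => p j * r k - p k * r j
  have hΔ : ∀ j k, (Δ j k).IsHomogeneous 2 := fun j k => ((hp j).mul (hr k)).sub ((hp k).mul (hr j))
  have key : ∀ l j k, ∃ c : ι → ι → ℂ, ∀ i, Δ j k * b l i + Δ k l * b j i + Δ l j * b k i
      = ∑ t, C (c i t) * v t := by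
    intro l j k
    refine syz_eq 3 v hv H _ (fun i => (((hΔ j k).mul (hb l i)).add ((hΔ k l).mul (hb j i))).add
      ((hΔ l j).mul (hb k i))) ?_
    simp only [add_mul, Finset.sum_add_distrib, mul_assoc, ← Finset.mul_sum, hs]
    simp only [Δ]; ring
  choose c hc using key
  have hlin : ∀ x : Fin 5 → ℂ, ∑ k, C (x k) * p k = 0 → ∑ k, C (x k) * r k = 0 → x = 0 := by
    intro x hx hx'
    have := hind (fun k => C (x k)) hx hx' (by
      refine syz_low 3 1 (by norm_num) v hv H _ (fun i => ?_) ?_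
      · refine IsHomogeneous.sum _ _ _ fun k _ => ?_
        simpa using (isHomogeneous_C (Fin N) (x k)).mul (hb k i)
      · simp only [Finset.sum_mul]
        rw [Finset.sum_comm]
        simp only [mul_assoc, ← Finset.mul_sum, hs]
        calc _ = - ((∑ k, C (x k) * p k) * u + (∑ k, C (x k) * r k) * w) := by
              rw [Finset.sum_mul, Finset.sum_mul, ← Finset.sum_add_distrib, ← Finset.sum_neg_distrib]
              exact Finset.sum_congr rfl fun _ _ => by ring
          _ = 0 := by rw [hx, hx']; simp)
    funext k
    have h1 := congrFun this k
    simpa using h1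
  have hc0 : ∀ s t, c 0 1 2 s t = 0 := by
    intro s t
    have e0 := hc 1 2 3 s
    have e1 := hc 0 2 3 s
    have e2 := hc 0 1 3 s
    have e3 := hc 0 1 2 s
    have hq : ∀ z : Fin 5 → MvPolynomial (Fin N) ℂ, (∀ k, (z k).IsHomogeneous 1) →
        (z 0 * (Δ 2 3 * b 1 s + Δ 3 1 * b 2 s + Δ 1 2 * b 3 s) - z 1 * (Δ 2 3 * b 0 s + Δ 3 0 * b 2 s + Δ 0 2 * b 3 s)
        + z 2 * (Δ 1 3 * b 0 s + Δ 3 0 * b 1 s + Δ 0 1 * b 3 s)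
        - z 3 * (Δ 1 2 * b 0 s + Δ 2 0 * b 1 s + Δ 0 1 * b 2 s) = 0) →
        z 0 * C (c 1 2 3 s t) - z 1 * C (c 0 2 3 s t) + z 2 * C (c 0 1 3 s t) - z 3 * C (c 0 1 2 s t) = 0 := by
      intro z hz h0
      have h1 : ∑ t, (z 0 * C (c 1 2 3 s t) - z 1 * C (c 0 2 3 s t) + z 2 * C (c 0 1 3 s t)
          - z 3 * C (c 0 1 2 s t)) * v t = 0 := by
        simp only [add_mul, sub_mul, Finset.sum_add_distrib, Finset.sum_sub_distrib, mul_assoc, ← Finset.mul_sum]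
        rw [← e1, ← e2, ← e3, ← e0]; exact h0
      have hh : ∀ k (y : ℂ), (z k * C y).IsHomogeneous 1 := fun k y => by
        simpa using (hz k).mul (isHomogeneous_C (Fin N) y)
      exact syz_low 3 1 (by norm_num) v hv H _ (fun t => (((hh _ _).sub (hh _ _)).add (hh _ _)).sub (hh _ _)) h1 t
    have h2 := hq p hp (by simp only [Δ]; ring)
    have h2' := hq r hr (by simp only [Δ]; ring)
    have h3 := hlin ![c 1 2 3 s t, - c 0 2 3 s t, c 0 1 3 s t, - c 0 1 2 s t, 0] (by
      rw [← h2]; simp [Fin.sum_univ_succ]; ring) (by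
      rw [← h2']; simp [Fin.sum_univ_succ]; ring)
    have := congrFun h3 3
    simpa using this
  have h012 : ∀ i, Δ 1 2 * b 0 i + Δ 2 0 * b 1 i + Δ 0 1 * b 2 i = 0 := by
    intro i; rw [hc]; simp [hc0]
  have h4 := hind ![Δ 1 2, Δ 2 0, Δ 0 1, 0, 0] (by simp [Fin.sum_univ_succ, Δ]; ring)
    (by simp [Fin.sum_univ_succ, Δ]; ring) (fun i => by
    simp [Fin.sum_univ_succ]; linear_combination h012 i)
  have hΔ0 : p 0 * r 1 - p 1 * r 0 = 0 := congrFun h4 2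
  have hz : ∀ z : Fin 5 → MvPolynomial (Fin N) ℂ, (∀ k, (z k).IsHomogeneous 1) →
      z 0 * p 1 - z 1 * p 0 = 0 → z 0 * r 1 - z 1 * r 0 = 0 → z 0 = 0 := by
    intro z hz h1 h2
    have h5 := hind ![-z 1, z 0, 0, 0, 0] (by simp [Fin.sum_univ_succ]; linear_combination h1)
      (by simp [Fin.sum_univ_succ]; linear_combination h2) (fun i => by
      have := syz_low 3 2 (by norm_num) v hv H (fun i => z 0 * b 1 i - z 1 * b 0 i)
        (fun i => ((hz 0).mul (hb 1 i)).sub ((hz 1).mul (hb 0 i))) (by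
          simp only [sub_mul, Finset.sum_sub_distrib, mul_assoc, ← Finset.mul_sum, hs]
          linear_combination (-u) * h1 - w * h2) i
      simp [Fin.sum_univ_succ]; linear_combination this)
    exact congrFun h5 1
  have hp0 := hz p hp (by ring) hΔ0
  have hr0 := hz r hr (by linear_combination -hΔ0) (by ring)
  have h6 := hlin ![1, 0, 0, 0, 0] (by simp [Fin.sum_univ_succ, hp0]) (by simp [Fin.sum_univ_succ, hr0])
  have := congrFun h6 0
  simp at this

theorem change {N e : ℕ} {ι κ : Type*} [Fintype ι] [Nonempty ι] [Fintype κ] (g : Fin N → MvPolynomial (Fin N) ℂ)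
    (w : ι → Fin N → ℂ) (hw : LinearIndependent ℂ w) (hcard : e + Fintype.card ι = N)
    (A : κ → Fin N → MvPolynomial (Fin N) ℂ) (hA : ∀ k i, (A k i).IsHomogeneous 1)
    (hs : ∀ k, ∑ i, A k i * g i = 0)
    (hind : ∀ c : κ → MvPolynomial (Fin N) ℂ, (∀ i, ∑ k, c k * A k i = 0) → c = 0) :
    ∃ (u : Fin e → MvPolynomial (Fin N) ℂ) (p : κ → Fin e → MvPolynomial (Fin N) ℂ)
      (b : κ → ι → MvPolynomial (Fin N) ℂ), (∀ k i, (p k i).IsHomogeneous 1) ∧ (∀ k i, (b k i).IsHomogeneous 1) ∧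
      (∀ k, ∑ x, p k x * u x + ∑ i, b k i * (∑ j, C (w i j) * g j) = 0) ∧
      ∀ c : κ → MvPolynomial (Fin N) ℂ, (∀ x, ∑ k, c k * p k x = 0) → (∀ i, ∑ k, c k * b k i = 0) → c = 0 := by
  classical
  obtain ⟨B, hB⟩ : ∃ B : Module.Basis (Fin e ⊕ ι) ℂ (Fin N → ℂ), ∀ i, B (Sum.inr i) = w i := by
    let W := Submodule.span ℂ (Set.range w)
    have hWd : Module.finrank ℂ W = Fintype.card ι := finrank_span_eq_card hw
    have hq : Module.finrank ℂ ((Fin N → ℂ) ⧸ W) = e := by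
      have := Submodule.finrank_quotient_add_finrank W
      rw [Module.finrank_fin_fun] at this
      omega
    let bq := Module.finBasisOfFinrankEq ℂ ((Fin N → ℂ) ⧸ W) hq
    choose y hy using fun x => W.mkQ_surjective (bq x)
    have hli : LinearIndependent ℂ (Sum.elim y w) := by
      rw [linearIndependent_sum]
      have hyq : LinearIndependent ℂ (W.mkQ ∘ y) := by
        have : W.mkQ ∘ y = bq := funext hy
        rw [this]; exact bq.linearIndependent
      refine ⟨LinearIndependent.of_comp W.mkQ hyq, hw, ?_⟩
      have h1 := hyq
      rw [Submodule.disjoint_def]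
      intro x hx hx'
      obtain ⟨a, rfl⟩ := (Submodule.mem_span_range_iff_exists_fun ℂ).mp hx
      have h2 : W.mkQ (∑ i, a i • y i) = 0 := by
        rw [Submodule.mkQ_apply, Submodule.Quotient.mk_eq_zero]; exact hx'
      rw [map_sum] at h2
      have h3 := Fintype.linearIndependent_iff.mp hyq a (by simpa using h2)
      simp [h3]
    refine ⟨basisOfLinearIndependentOfCardEqFinrank hli (by simp [hcard]), fun i => by simp⟩
  let Q : Fin N → (Fin e ⊕ ι) → ℂ := fun j x => B.repr (Pi.single j 1) x
  have hQ : ∀ j i, ∑ x, C (Q j x) * C (B x i) = if i = j then (1 : MvPolynomial (Fin N) ℂ) else 0 := by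
    intro j i
    have := congrFun (B.sum_repr (Pi.single j 1)) i
    rw [Finset.sum_apply] at this
    simp only [Pi.smul_apply, smul_eq_mul] at this
    simp only [← C_mul, ← map_sum]
    rw [this]
    by_cases hij : i = j
    · subst hij; simp
    · simp [hij]
  let A' : κ → (Fin e ⊕ ι) → MvPolynomial (Fin N) ℂ := fun k x => ∑ j, A k j * C (Q j x)
  have hA' : ∀ k x, (A' k x).IsHomogeneous 1 := fun k x =>
    IsHomogeneous.sum _ _ _ fun j _ => by simpa using (hA k j).mul (isHomogeneous_C (Fin N) (Q j x))
  have hrec : ∀ k i, ∑ x, A' k x * C (B x i) = A k i := by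
    intro k i
    simp only [A', Finset.sum_mul]
    rw [Finset.sum_comm]
    simp only [mul_assoc, ← Finset.mul_sum, hQ]
    simp
  let G : (Fin e ⊕ ι) → MvPolynomial (Fin N) ℂ := fun x => ∑ j, C (B x j) * g j
  have hG : ∀ k, ∑ x, A' k x * G x = 0 := by
    intro k
    rw [← hs k]
    simp only [G, Finset.mul_sum]
    rw [Finset.sum_comm]
    refine Finset.sum_congr rfl fun i _ => ?_
    rw [← hrec k i, Finset.sum_mul]
    exact Finset.sum_congr rfl fun x _ => by ring
  refine ⟨fun x => G (Sum.inl x), fun k x => A' k (Sum.inl x), fun k i => A' k (Sum.inr i),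
    fun k x => hA' _ _, fun k x => hA' _ _, fun k => ?_, fun c h1 h2 => hind c fun i => ?_⟩
  · have := hG k
    rw [Fintype.sum_sum_type] at this
    simpa only [G, hB] using this
  · have h3 : ∀ x, ∑ k, c k * A' k x = 0 := by rintro (x | x); exacts [h1 x, h2 x]
    calc ∑ k, c k * A k i = ∑ x, (∑ k, c k * A' k x) * C (B x i) := by
          simp only [Finset.sum_mul]
          rw [Finset.sum_comm]
          refine Finset.sum_congr rfl fun k _ => ?_
          rw [← hrec k i, Finset.mul_sum]
          exact Finset.sum_congr rfl fun x _ => by ring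
      _ = 0 := by simp [h3]

end TI

namespace TI

theorem H1_sub {N : ℕ} {ι : Type*} [DecidableEq ι] [Fintype ι] (P : ι → Prop) [DecidablePred P]
    (f : ι → MvPolynomial (Fin N) ℂ) (H : H1 (Finset.univ.filter P) f) :
    H1 (Finset.univ : Finset {i // P i}) (fun i => f i.1) := by
  intro a ha
  have hsum : ∀ g : ι → MvPolynomial (Fin N) ℂ, ∑ i ∈ Finset.univ.filter P, g i = ∑ i : {i // P i}, g i.1 :=
    fun g => Finset.sum_subtype _ (by simp) _
  obtain ⟨c, h1, h2⟩ := H (fun i => if h : P i then a ⟨i, h⟩ else 0) (by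
    rw [hsum, ← ha]
    refine Finset.sum_congr rfl fun i _ => ?_
    rw [dif_pos i.2])
  refine ⟨fun i j => c i.1 j.1, fun i j => h1 _ _, fun i _ => ?_⟩
  have := h2 i.1 (by simp [i.2])
  rw [hsum, dif_pos i.2] at this
  exact this

theorem data {n q m : ℕ} (hn : 3 ≤ n) (hm : m + 3 = n) (hq : 2 ≤ q) (F : Fin (n + 1) → MvPolynomial (Fin (n + 1)) ℂ)
    (hF : ∀ i, (F i).IsHomogeneous q) (hF0 : ∀ x : Fin (n + 1) → ℂ, (∀ i, eval x (F i) = 0) → x = 0)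
    (h : MvPolynomial (Fin (n + 1)) ℂ) (lam : ℂ) (hinv : aeval F h = C lam * h ^ q)
    (hh : h.IsHomogeneous (m + 2))
    (hdim : ringKrullDim (MvPolynomial (Fin (n + 1)) ℂ ⧸ jacobianIdeal (n + 1) h) ≤ m) :
    ∃ v : {i : Fin (n + 1) // m ≤ i} → MvPolynomial (Fin (n + 1)) ℂ, (∀ i, (v i).IsHomogeneous (m + 1)) ∧
      H1 Finset.univ v ∧
    ∃ (u : Fin m → MvPolynomial (Fin (n + 1)) ℂ) (p : Fin n → Fin m → MvPolynomial (Fin (n + 1)) ℂ)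
      (b : Fin n → {i : Fin (n + 1) // m ≤ i} → MvPolynomial (Fin (n + 1)) ℂ),
      (∀ k i, (p k i).IsHomogeneous 1) ∧ (∀ k i, (b k i).IsHomogeneous 1) ∧
      (∀ k, ∑ x, p k x * u x + ∑ i, b k i * v i = 0) ∧
      ∀ c : Fin n → MvPolynomial (Fin (n + 1)) ℂ, (∀ x, ∑ k, c k * p k x = 0) →
        (∀ i, ∑ k, c k * b k i = 0) → c = 0 := by
  classical
  let g : Fin (n + 1) → MvPolynomial (Fin (n + 1)) ℂ := fun i => pderiv i h
  have hg : ∀ i, (g i).IsHomogeneous (m + 1) := fun i => hh.pderiv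
  let V := Submodule.span ℂ (Set.range g)
  have hV : ∀ v ∈ V, v.IsHomogeneous (m + 1) := by
    intro v hv
    have : V ≤ homogeneousSubmodule (Fin (n + 1)) ℂ (m + 1) := by
      rw [Submodule.span_le]; rintro _ ⟨i, rfl⟩; exact hg i
    exact this hv
  have hJ : jacobianIdeal (n + 1) h = Ideal.span (V : Set (MvPolynomial (Fin (n + 1)) ℂ)) := by
    apply le_antisymm
    · have hgm : ∀ i, g i ∈ Ideal.span (V : Set (MvPolynomial (Fin (n + 1)) ℂ)) := fun i =>
        Ideal.subset_span (Submodule.subset_span ⟨i, rfl⟩)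
      rw [jacobianIdeal, Ideal.span_le, Set.insert_subset_iff]
      refine ⟨?_, ?_⟩
      · have he := hh.sum_X_mul_pderiv
        have h1 : ((m + 2 : ℕ) • h) ∈ Ideal.span (V : Set (MvPolynomial (Fin (n + 1)) ℂ)) := by
          rw [← he]
          exact Ideal.sum_mem _ fun i _ => Ideal.mul_mem_left _ _ (hgm i)
        have h2 : h = C ((m + 2 : ℕ) : ℂ)⁻¹ * ((m + 2 : ℕ) • h) := by
          have h3 : ((m + 2 : ℕ) : ℂ) ≠ 0 := Nat.cast_ne_zero.mpr (by omega)
          rw [nsmul_eq_mul, ← mul_assoc, ← map_natCast (C : ℂ →+* MvPolynomial (Fin (n + 1)) ℂ), ← C_mul,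
            inv_mul_cancel₀ h3, C_1, one_mul]
        change h ∈ Ideal.span (V : Set (MvPolynomial (Fin (n + 1)) ℂ))
        rw [h2]
        exact Ideal.mul_mem_left _ _ h1
      · rintro _ ⟨i, rfl⟩; exact hgm i
    · rw [Ideal.span_le]
      have : V ≤ (jacobianIdeal (n + 1) h).restrictScalars ℂ := by
        rw [Submodule.span_le]; rintro _ ⟨i, rfl⟩
        exact Ideal.subset_span (Or.inr ⟨i, rfl⟩)
      exact this
  rw [hJ] at hdim
  obtain ⟨f, H, hf⟩ := cut (m + 1) (Nat.succ_pos _) V hV m (by omega) (Dle_of_dim _ _ hdim)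
  have H' := H1_sub _ _ H
  have hw : ∀ i : {i : Fin (n + 1) // m ≤ i}, ∃ w : Fin (n + 1) → ℂ, ∑ j, C (w j) * g j = f i.1 := by
    intro i
    obtain ⟨c, hc⟩ := (Submodule.mem_span_range_iff_exists_fun ℂ).mp (hf i.1 i.2)
    refine ⟨c, ?_⟩
    rw [← hc]
    exact Finset.sum_congr rfl fun j _ => (smul_eq_C_mul _ _).symm
  choose w hw using hw
  have hvh : ∀ i : {i : Fin (n + 1) // m ≤ i}, (f i.1).IsHomogeneous (m + 1) := fun i => hV _ (hf i.1 i.2)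
  have hli : LinearIndependent ℂ w := by
    rw [Fintype.linearIndependent_iff]
    intro x hx i
    have := syz_low (m + 1) 0 (Nat.succ_pos _) _ hvh H' (fun i => C (x i)) (fun i => isHomogeneous_C _ _) (by
      simp only [← hw, Finset.mul_sum]
      rw [Finset.sum_comm]
      refine Finset.sum_eq_zero fun j _ => ?_
      have h1 := congrFun hx j
      rw [Finset.sum_apply] at h1
      simp only [← mul_assoc, ← C_mul, ← Finset.sum_mul, ← map_sum]
      simp only [Pi.smul_apply, smul_eq_mul, Pi.zero_apply] at h1
      rw [h1]; simp) i
    simpa using this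
  obtain ⟨A, hA1, hA2, hA3⟩ := rank hq F hF hF0 h lam hinv (m + 2) hh
  haveI : Nonempty {i : Fin (n + 1) // m ≤ i} := ⟨⟨⟨m, by omega⟩, le_rfl⟩⟩
  have hcard : m + Fintype.card {i : Fin (n + 1) // m ≤ i} = n + 1 := by
    have h1 := Fintype.card_subtype_compl (fun i : Fin (n + 1) => (i : ℕ) < m)
    have h2 : Fintype.card {i : Fin (n + 1) // (i : ℕ) < m} = m := by
      rw [Fintype.card_congr (Fin.castLEquiv (show m ≤ n + 1 by omega)).symm]; simp
    have h3 : Fintype.card {i : Fin (n + 1) // m ≤ i} = Fintype.card {i : Fin (n + 1) // ¬ (i : ℕ) < m} :=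
      Fintype.card_congr (Equiv.subtypeEquivRight (by simp))
    rw [h3, h1, h2, Fintype.card_fin]; omega
  obtain ⟨u, p, b, h1, h2, h3, h4⟩ := change (e := m) g w hli hcard A hA1 hA2 hA3
  refine ⟨fun i => f i.1, hvh, H', u, p, b, h1, h2, ?_, h4⟩
  simpa only [hw] using h3

theorem lower4 {q : ℕ} (hq : 2 ≤ q) (F : Fin 5 → MvPolynomial (Fin 5) ℂ)
    (hF : ∀ i, (F i).IsHomogeneous q) (hF0 : ∀ x : Fin 5 → ℂ, (∀ i, eval x (F i) = 0) → x = 0)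
    (h : MvPolynomial (Fin 5) ℂ) (lam : ℂ) (hinv : aeval F h = C lam * h ^ q)
    (hh : h.IsHomogeneous 3)
    (hdim : ringKrullDim (MvPolynomial (Fin 5) ℂ ⧸ jacobianIdeal 5 h) ≤ (1 : ℕ)) : False := by
  obtain ⟨v, hv, H, u, p, b, h1, h2, h3, h4⟩ := data (n := 4) (m := 1) (by norm_num) rfl hq F hF hF0 h lam hinv hh hdim
  refine core1 v hv H (u 0) (fun k => p k 0) b (fun k => h1 k 0) h2 (fun k => ?_) (fun c g1 g2 => h4 c ?_ g2)
  · have := h3 k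
    rw [Fin.sum_univ_one] at this
    linear_combination this
  · intro x; rw [Subsingleton.elim x 0]; exact g1

theorem lower5 {q : ℕ} (hq : 2 ≤ q) (F : Fin 6 → MvPolynomial (Fin 6) ℂ)
    (hF : ∀ i, (F i).IsHomogeneous q) (hF0 : ∀ x : Fin 6 → ℂ, (∀ i, eval x (F i) = 0) → x = 0)
    (h : MvPolynomial (Fin 6) ℂ) (lam : ℂ) (hinv : aeval F h = C lam * h ^ q)
    (hh : h.IsHomogeneous 4)
    (hdim : ringKrullDim (MvPolynomial (Fin 6) ℂ ⧸ jacobianIdeal 6 h) ≤ (2 : ℕ)) : False := by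
  obtain ⟨v, hv, H, u, p, b, h1, h2, h3, h4⟩ := data (n := 5) (m := 2) (by norm_num) rfl hq F hF hF0 h lam hinv hh hdim
  refine core2 v hv H (u 0) (u 1) (fun k => p k 0) (fun k => p k 1) b (fun k => h1 k 0) (fun k => h1 k 1) h2
    (fun k => ?_) (fun c g1 g2 g3 => h4 c ?_ g3)
  · have := h3 k
    rw [Fin.sum_univ_two] at this
    linear_combination this
  · intro x
    fin_cases x
    exacts [g1, g2]

theorem upper (n : ℕ) (hn : 2 ≤ n) (h : MvPolynomial (Fin (n + 1)) ℂ) (hirr : Irreducible h)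
    (hhom : h.IsHomogeneous (n - 1)) :
    ringKrullDim (MvPolynomial (Fin (n + 1)) ℂ ⧸ jacobianIdeal (n + 1) h) ≤ ((n - 1 : ℕ) : WithBot ℕ∞) := by
  obtain ⟨i, hi⟩ : ∃ i, pderiv i h ≠ 0 := by
    by_contra hcon
    push Not at hcon
    have he := hhom.sum_X_mul_pderiv
    simp only [hcon, mul_zero, Finset.sum_const_zero] at he
    have := he.symm
    rw [nsmul_eq_mul, mul_eq_zero] at this
    rcases this with h1 | h1
    · have : n - 1 = 0 := by exact_mod_cast h1
      omega
    · exact hirr.ne_zero h1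
  have hprime : Prime h := hirr.prime
  haveI : (Ideal.span {h}).IsPrime := (Ideal.span_singleton_prime hirr.ne_zero).mpr hprime
  have hnd : ¬ h ∣ pderiv i h := by
    intro hd
    have h1 := MvPolynomial.totalDegree_le_of_dvd_of_isDomain hd hi
    rw [hhom.totalDegree hirr.ne_zero, (hhom.pderiv (i := i)).totalDegree hi] at h1
    omega
  have hle : Ideal.span {h} ≤ jacobianIdeal (n + 1) h := by
    rw [Ideal.span_singleton_le_iff_mem]; exact Ideal.subset_span (Or.inl rfl)
  have d0 : ringKrullDim (MvPolynomial (Fin (n + 1)) ℂ) = ((n + 1 : ℕ) : WithBot ℕ∞) := by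
    rw [MvPolynomial.ringKrullDim_of_isNoetherianRing, ringKrullDim_eq_zero_of_field]; simp
  have d1 := ringKrullDim_succ_le_of_surjective (Ideal.Quotient.mk (Ideal.span {h})) Ideal.Quotient.mk_surjective
    (mem_nonZeroDivisors_of_ne_zero hirr.ne_zero) (Ideal.Quotient.eq_zero_iff_mem.mpr (Ideal.mem_span_singleton_self h))
  have d2 := ringKrullDim_succ_le_of_surjective (Ideal.Quotient.factor hle) (Ideal.Quotient.factor_surjective hle)
    (r := Ideal.Quotient.mk _ (pderiv i h)) (mem_nonZeroDivisors_of_ne_zero (by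
      rw [Ne, Ideal.Quotient.eq_zero_iff_mem, Ideal.mem_span_singleton]; exact hnd)) (by
      rw [Ideal.Quotient.factor_mk, Ideal.Quotient.eq_zero_iff_mem]
      exact Ideal.subset_span (Or.inr ⟨i, rfl⟩))
  rw [d0] at d1
  generalize ringKrullDim (MvPolynomial (Fin (n + 1)) ℂ ⧸ jacobianIdeal (n + 1) h) = x at *
  generalize ringKrullDim (MvPolynomial (Fin (n + 1)) ℂ ⧸ Ideal.span {h}) = y at *
  have d3 : x + 1 + 1 ≤ ((n + 1 : ℕ) : WithBot ℕ∞) := (add_le_add_left d2 1).trans d1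
  induction x with
  | bot => exact bot_le
  | coe x =>
    have d4 : x + 1 + 1 ≤ ((n + 1 : ℕ) : ℕ∞) := WithBot.coe_le_coe.mp d3
    have d5 : x ≤ ((n - 1 : ℕ) : ℕ∞) := by
      cases x with
      | top => simp at d4
      | coe x =>
        have d6 : x + 1 + 1 ≤ n + 1 := by exact_mod_cast d4
        have : x ≤ n - 1 := by omega
        exact_mod_cast this
    exact WithBot.coe_le_coe.mpr d5

theorem dim_dichotomy (m : ℕ) (x : WithBot ℕ∞) (h1 : x ≤ ((m + 2 : ℕ) : WithBot ℕ∞))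
    (h2 : ¬ x ≤ ((m : ℕ) : WithBot ℕ∞)) :
    (x = ((m + 2 : ℕ) : WithBot ℕ∞) ∨ x = ((m + 1 : ℕ) : WithBot ℕ∞)) ∧ ((m + 1 : ℕ) : WithBot ℕ∞) ≤ x := by
  induction x with
  | bot => exact absurd bot_le h2
  | coe x =>
    have d1 : x ≤ ((m + 2 : ℕ) : ℕ∞) := WithBot.coe_le_coe.mp h1
    have d2 : ¬ x ≤ ((m : ℕ) : ℕ∞) := fun h => h2 (WithBot.coe_le_coe.mpr h)
    cases x with
    | top => exact absurd d1 (by simp)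
    | coe x =>
      have d3 : x ≤ m + 2 := by exact_mod_cast d1
      have d4 : ¬ x ≤ m := by exact_mod_cast d2
      have d5 : x = m + 2 ∨ x = m + 1 := by omega
      rcases d5 with rfl | rfl
      · exact ⟨Or.inl rfl, WithBot.coe_le_coe.mpr (by exact_mod_cast (by omega : m + 1 ≤ m + 2))⟩
      · exact ⟨Or.inr rfl, le_rfl⟩

end TI

/-- For `n ∈ {4, 5}`, a totally invariant irreducible hypersurface of `ℙⁿ` of degree `n - 1`
has singular locus of dimension `n - 2` or `n - 3`: the Jacobian ring has Krull dimension
`n - 1` or `n - 2` (in particular `≥ n - 2`). -/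
theorem degree_n_sub_one_small_n (n : ℕ) (hn : n = 4 ∨ n = 5)
    (h : MvPolynomial (Fin (n + 1)) ℂ) (hirr : Irreducible h)
    (hhom : h.IsHomogeneous (n - 1)) (hinv : IsTotallyInvariant (n + 1) h) :
    (ringKrullDim (MvPolynomial (Fin (n + 1)) ℂ ⧸ jacobianIdeal (n + 1) h)
        = ((n - 1 : ℕ) : WithBot ℕ∞) ∨
      ringKrullDim (MvPolynomial (Fin (n + 1)) ℂ ⧸ jacobianIdeal (n + 1) h)
        = ((n - 2 : ℕ) : WithBot ℕ∞)) ∧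
    ((n - 2 : ℕ) : WithBot ℕ∞) ≤
      ringKrullDim (MvPolynomial (Fin (n + 1)) ℂ ⧸ jacobianIdeal (n + 1) h) := by
  obtain ⟨q, hq, F, ⟨hF, hF0⟩, lam, -, hF1⟩ := hinv
  have hup := TI.upper n (by omega) h hirr hhom
  rcases hn with rfl | rfl
  · exact TI.dim_dichotomy 1 _ hup fun hd => TI.lower4 hq F hF hF0 h lam hF1 hhom hd
  · exact TI.dim_dichotomy 2 _ hup fun hd => TI.lower5 hq F hF hF0 h lam hF1 hhom hd
end

section
/- Let n ≥ 9 and let h ∈ ℂ[X₀,…,Xₙ] be an irreducible homogeneous polynomial of degree n − 2 defining a totally invariant hypersurface X = {h = 0} ⊂ ℙⁿ(ℂ). Then X is not normal: its singular locus has dimension n − 2, i.e. the Jacobian ring J(h) has Krull dimension ≥ n − 1. -/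
open MvPolynomial

lemma hc_mul {σ : Type*} {e p : ℕ} (a b : MvPolynomial σ ℂ) (hb : b.IsHomogeneous p) :
    homogeneousComponent (e + p) (a * b) = homogeneousComponent e a * b := by
  conv_lhs => rw [← sum_homogeneousComponent a]
  rw [Finset.sum_mul, map_sum]
  have : ∀ i, homogeneousComponent (e + p) (homogeneousComponent i a * b) =
      if i = e then homogeneousComponent e a * b else 0 := by
    intro i
    rw [homogeneousComponent_of_mem
      (((homogeneousComponent_isHomogeneous i a).mul hb) : _ ∈ homogeneousSubmodule _ _ _)]
    by_cases h : i = e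
    · simp [h]
    · rw [if_neg h, if_neg (by omega)]
  simp only [this]
  rw [Finset.sum_ite_eq' ]
  split_ifs with h
  · rfl
  · rw [homogeneousComponent_eq_zero, zero_mul]
    simp at h; omega

lemma det_hom {σ : Type*} {N : ℕ} (A : Matrix (Fin N) (Fin N) (MvPolynomial σ ℂ)) (d : Fin N → ℕ)
    (hA : ∀ l i, (A l i).IsHomogeneous (d l)) : A.det.IsHomogeneous (∑ l, d l) := by
  rw [← Matrix.det_transpose, Matrix.det_apply]
  refine IsHomogeneous.sum _ _ _ fun τ _ => ?_
  have h := IsHomogeneous.prod Finset.univ (fun i => A.transpose (τ i) i) d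
    (fun i _ => hA i (τ i))
  rcases Int.units_eq_one_or (Equiv.Perm.sign τ) with hs | hs
  · simpa [hs] using h
  · simpa [hs] using h.neg

lemma dvd_zero_of_deg {σ : Type*} {e p : ℕ} {a b : MvPolynomial σ ℂ} (ha : a.IsHomogeneous p)
    (hb : b.IsHomogeneous e) (hep : e < p) (h : a ∣ b) : b = 0 := by
  by_contra hb0
  obtain ⟨c, rfl⟩ := h
  have ha0 : a ≠ 0 := left_ne_zero_of_mul hb0
  have hc0 : c ≠ 0 := right_ne_zero_of_mul hb0
  have := hb.totalDegree hb0
  rw [totalDegree_mul_of_isDomain ha0 hc0, ha.totalDegree ha0] at this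
  omega

lemma core {N : ℕ} (s r p e : ℕ) (x : Fin N → MvPolynomial (Fin N) ℂ)
    (M : Matrix (Fin N) (Fin N) (MvPolynomial (Fin N) ℂ)) (η : Fin N → MvPolynomial (Fin N) ℂ)
    (g : MvPolynomial (Fin N) ℂ)
    (hx : ∀ l, (x l).IsHomogeneous p) (hM : ∀ l i, (M l i).IsHomogeneous s)
    (hη : ∀ i, (η i).IsHomogeneous r) (hrel : ∀ i, ∑ l, x l * M l i = g * η i)
    (j k : Fin N) (hjk : j ≠ k) (hcop : IsRelPrime (x j) (x k))
    (hcol : ∀ y, (∀ l, x l * y ∈ Ideal.span {x j, x k}) → y ∈ Ideal.span {x j, x k})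
    (he : (N - 2) * s + r = e + p) (h1 : e + s < p) (h2 : e + r < p)
    (hxj : x j ≠ 0) (hxk : x k ≠ 0) : M.det = 0 := by
  classical
  set M' := M.updateRow j η with hM'
  set m : Fin N → MvPolynomial (Fin N) ℂ := fun i => M'.adjugate i k with hm
  have hadj : ∀ l, ∑ i, M' l i * m i = if l = k then M'.det else 0 := by
    intro l
    have := congrFun (congrFun (Matrix.mul_adjugate M') l) k
    rw [Matrix.mul_apply] at this
    simpa [Matrix.one_apply] using this
  have hηm : ∑ i, η i * m i = 0 := by
    have := hadj j
    simpa [hM', hjk] using this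
  have hMm : ∀ l, l ≠ j → ∑ i, M l i * m i = if l = k then M'.det else 0 := by
    intro l hl
    have := hadj l
    simpa [hM', Matrix.updateRow_ne hl] using this
  -- weighted sum
  have hw : ∀ v : Fin N → MvPolynomial (Fin N) ℂ,
      ∑ l, x l * ∑ i, M l i * v i = g * ∑ i, η i * v i := by
    intro v
    simp only [Finset.mul_sum]
    rw [Finset.sum_comm]
    refine Finset.sum_congr rfl fun i _ => ?_
    rw [← mul_assoc, ← hrel i, Finset.sum_mul]
    exact Finset.sum_congr rfl fun l _ => by ring
  have hjm : x j * ∑ i, M j i * m i + x k * M'.det = 0 := by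
    have := hw m
    rw [hηm, mul_zero, ← Finset.add_sum_erase _ _ (Finset.mem_univ j)] at this
    rw [← this]
    congr 1
    rw [Finset.sum_congr rfl (fun l hl => by rw [hMm l (Finset.ne_of_mem_erase hl)])]
    simp [hjk.symm]
  have hdvd : x j ∣ M'.det := by
    refine hcop.dvd_of_dvd_mul_left ⟨- ∑ i, M j i * m i, ?_⟩
    linear_combination hjm
  obtain ⟨R, hR⟩ := hdvd
  have hjm' : ∑ i, M j i * m i = - (x k * R) := by
    apply mul_left_cancel₀ hxj
    rw [hR] at hjm
    linear_combination hjm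
  have hdet : x j * M.det = g * M'.det := by
    have h3 := Matrix.det_updateRow_sum M j x
    have h4 : (∑ l, x l • M l) = g • η := by
      ext1 i
      simpa [Finset.sum_apply] using hrel i
    rw [h4, Matrix.det_updateRow_smul] at h3
    simpa using h3.symm
  -- degree of m
  have hmhom : ∀ i, (m i).IsHomogeneous (e + p) := by
    intro i
    have : m i = (M'.updateRow k (Pi.single i 1)).det := by
      simp [hm, Matrix.adjugate_apply]
    rw [this, ← he]
    have h5 := det_hom (M'.updateRow k (Pi.single i 1))
      (fun l => if l = k then 0 else if l = j then r else s) ?_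
    · convert h5 using 1
      rw [← Finset.add_sum_erase _ _ (Finset.mem_univ k),
        ← Finset.add_sum_erase _ _ (Finset.mem_erase.2 ⟨hjk, Finset.mem_univ j⟩)]
      rw [Finset.sum_congr rfl (g := fun _ => s)]
      · simp [hjk, Finset.card_erase_of_mem, hjk.symm]
        rw [show N - 1 - 1 = N - 2 by omega]; ring
      · intro l hl
        simp at hl
        simp [hl]
    · intro l i'
      by_cases hlk : l = k
      · subst hlk
        simp [Pi.single_apply]
        split_ifs
        · exact isHomogeneous_one _ _
        · exact isHomogeneous_zero _ _ _
      · by_cases hlj : l = j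
        · subst hlj
          simp [hlk, hM', Matrix.updateRow_ne hlk, hη]
        · simp [hlk, hlj, hM', Matrix.updateRow_ne hlk, Matrix.updateRow_ne hlj, hM]
  have hmem : ∀ i, m i ∈ Ideal.span {x j, x k} := by
    intro i
    apply hcol
    intro l
    by_cases hlj : l = j
    · subst hlj; exact Ideal.mul_mem_right _ _ (Ideal.subset_span (by simp))
    by_cases hlk : l = k
    · subst hlk; exact Ideal.mul_mem_right _ _ (Ideal.subset_span (by simp))
    set A := M'.updateRow k (Pi.single i 1) with hA
    have hmA : m i = A.det := by
      simp [hm, hA, Matrix.adjugate_apply]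
    set w : Fin N → MvPolynomial (Fin N) ℂ :=
      fun l => if l = j then -g else if l = k then 0 else x l with hwdef
    have hwA : ∀ t, ∑ l, w l * A l t = -(x j * M j t + x k * M k t) := by
      intro t
      have h6 := hrel t
      rw [← Finset.add_sum_erase _ _ (Finset.mem_univ j),
        ← Finset.add_sum_erase _ _ (Finset.mem_erase.2 ⟨hjk.symm, Finset.mem_univ k⟩)] at h6 ⊢
      rw [Finset.sum_congr rfl (g := fun l => x l * M l t)]
      · have e1 : A j t = η t := by simp [hA, Matrix.updateRow_ne hjk, hM']
        have e2 : w j = -g := by simp [hwdef]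
        have e3 : w k = 0 := by simp [hwdef, hjk.symm]
        rw [e1, e2, e3]
        linear_combination h6
      · intro l hl
        simp at hl
        simp [hwdef, hl, hA, hM', Matrix.updateRow_ne hl.1, Matrix.updateRow_ne hl.2]
    have h7 : w l * A.det = ∑ t, (-(x j * M j t + x k * M k t)) * A.adjugate t l := by
      simp only [← hwA, Finset.sum_mul]
      rw [Finset.sum_comm]
      have : ∀ y, ∑ t, w y * A y t * A.adjugate t l = w y * (if y = l then A.det else 0) := by
        intro y
        have := congrFun (congrFun (Matrix.mul_adjugate A) y) l
        rw [Matrix.mul_apply] at this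
        simp only [mul_assoc, ← Finset.mul_sum, this]
        simp [Matrix.one_apply]
      simp [this]
    have hwl : w l = x l := by simp [hwdef, hlj, hlk]
    rw [hmA, ← hwl, h7]
    refine Ideal.sum_mem _ fun t _ => Ideal.mul_mem_right _ _ ?_
    refine neg_mem (add_mem ?_ ?_)
    · exact Ideal.mul_mem_right _ _ (Ideal.subset_span (by simp))
    · exact Ideal.mul_mem_right _ _ (Ideal.subset_span (by simp))
  have hab : ∀ i, ∃ a b : MvPolynomial (Fin N) ℂ, a.IsHomogeneous e ∧ b.IsHomogeneous e ∧
      a * x j + b * x k = m i := by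
    intro i
    obtain ⟨a, b, hab⟩ := Ideal.mem_span_pair.1 (hmem i)
    refine ⟨homogeneousComponent e a, homogeneousComponent e b,
      homogeneousComponent_isHomogeneous _ _, homogeneousComponent_isHomogeneous _ _, ?_⟩
    rw [← hc_mul _ _ (hx j), ← hc_mul _ _ (hx k), ← map_add, hab,
      homogeneousComponent_eq_self (hmhom i)]
  choose α β hα hβ hαβ using hab
  have hsplit : ∀ v : Fin N → MvPolynomial (Fin N) ℂ,
      ∑ i, v i * m i = (∑ i, v i * α i) * x j + (∑ i, v i * β i) * x k := by
    intro v
    simp only [← hαβ, Finset.sum_mul, ← Finset.sum_add_distrib]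
    exact Finset.sum_congr rfl fun i _ => by ring
  have hhomv : ∀ (v u : Fin N → MvPolynomial (Fin N) ℂ) (t : ℕ), (∀ i, (v i).IsHomogeneous t) →
      (∀ i, (u i).IsHomogeneous e) → (∑ i, v i * u i).IsHomogeneous (e + t) := by
    intro v u t hv hu
    rw [add_comm]
    exact IsHomogeneous.sum _ _ _ fun i _ => (hv i).mul (hu i)
  have hαη : ∑ i, η i * α i = 0 := by
    apply dvd_zero_of_deg (hx k) (hhomv η α r hη hα) h2
    have h8 := hsplit η
    rw [hηm] at h8
    refine hcop.symm.dvd_of_dvd_mul_left ⟨- ∑ i, η i * β i, ?_⟩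
    linear_combination -h8
  have hαl : ∀ l, l ≠ k → ∑ i, M l i * α i = 0 := by
    intro l hlk
    apply dvd_zero_of_deg (hx k) (hhomv (M l) α s (hM l) hα) h1
    have h8 := hsplit (M l)
    by_cases hlj : l = j
    · subst hlj
      rw [hjm'] at h8
      refine hcop.symm.dvd_of_dvd_mul_left ⟨- R - ∑ i, M l i * β i, ?_⟩
      linear_combination -h8
    · rw [hMm l hlj, if_neg hlk] at h8
      refine hcop.symm.dvd_of_dvd_mul_left ⟨- ∑ i, M l i * β i, ?_⟩
      linear_combination -h8
  have hβk : ∑ i, M k i * β i = 0 := by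
    apply dvd_zero_of_deg (hx j) (hhomv (M k) β s (hM k) hβ) h1
    have h8 := hsplit (M k)
    rw [hMm k hjk.symm, if_pos rfl, hR] at h8
    refine hcop.dvd_of_dvd_mul_left ⟨R - ∑ i, M k i * α i, ?_⟩
    linear_combination -h8
  have hαk : ∑ i, M k i * α i = R := by
    have h8 := hsplit (M k)
    rw [hMm k hjk.symm, if_pos rfl, hR, hβk] at h8
    apply mul_left_cancel₀ hxj
    linear_combination -h8
  have h9 := hw α
  rw [hαη, mul_zero, Finset.sum_eq_single k, hαk] at h9
  · have hR0 : R = 0 := by simpa [hxk] using h9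
    rw [hR, hR0] at hdet
    simpa [hxj] using hdet
  · intro l _ hlk
    rw [hαl l hlk, mul_zero]
  · simp


/-- integral maps do not raise dimension -/
lemma dim_le_of_integral {A B : Type*} [CommRing A] [CommRing B] (f : A →+* B)
    (hf : f.IsIntegral) : ringKrullDim B ≤ ringKrullDim A := by
  algebraize [f]
  have : Algebra.IsIntegral A B := ⟨hf⟩
  refine Order.krullDim_le_of_strictMono (PrimeSpectrum.comap f) ?_
  intro P Q h
  exact Ideal.IsIntegral.comap_lt_comap (R := A) (A := B) h

lemma dim_ge_of_integral {A B : Type*} [CommRing A] [CommRing B] (f : A →+* B)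
    (hf : f.IsIntegral) (hinj : Function.Injective f) : ringKrullDim A ≤ ringKrullDim B := by
  algebraize [f]
  have : Algebra.IsIntegral A B := ⟨hf⟩
  have : FaithfulSMul A B := (faithfulSMul_iff_algebraMap_injective A B).2 hinj
  refine iSup_le fun l => ?_
  obtain ⟨⟨P, hP, hP'⟩⟩ := Ideal.nonempty_primesOver (S := B) (P := (RelSeries.head l).asIdeal)
  obtain ⟨L, hL, -⟩ := Ideal.exists_ltSeries_of_hasGoingUp l P
  rw [← hL]
  exact le_iSup (fun p : LTSeries (PrimeSpectrum B) => (p.length : WithBot ℕ∞)) L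

open Polynomial in
/-- colon lemma, elementary unmixedness -/
lemma colon_aux {B : Type*} [CommRing B] [IsDomain B] [UniqueFactorizationMonoid B]
    (f x1 y : B[X]) (hf : f.Monic) (hcop : IsRelPrime f x1) (u v : B) (hu : u ≠ 0)
    (huv : IsRelPrime u v)
    (h1 : Polynomial.C u * y ∈ Ideal.span {f, x1}) (h2 : Polynomial.C v * y ∈ Ideal.span {f, x1}) :
    y ∈ Ideal.span {f, x1} := by
  obtain ⟨a1, a2, ha⟩ := Ideal.mem_span_pair.1 h1
  obtain ⟨b1, b2, hb⟩ := Ideal.mem_span_pair.1 h2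
  have ha2 := modByMonic_add_div a2 f
  have hb2 := modByMonic_add_div b2 f
  set a3 := a2 %ₘ f with ha3
  set b3 := b2 %ₘ f with hb3
  have hdv : f ∣ (Polynomial.C v * a3 - Polynomial.C u * b3) := by
    refine hcop.dvd_of_dvd_mul_left ⟨-Polynomial.C v * (a1 + (a2 /ₘ f) * x1) + Polynomial.C u * (b1 + (b2 /ₘ f) * x1), ?_⟩
    linear_combination Polynomial.C v * ha - Polynomial.C u * hb + Polynomial.C v * x1 * ha2 - Polynomial.C u * x1 * hb2
  have hz : Polynomial.C v * a3 - Polynomial.C u * b3 = 0 := by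
    have h3 := (modByMonic_eq_zero_iff_dvd hf).2 hdv
    rw [sub_modByMonic, ← Polynomial.smul_eq_C_mul, ← Polynomial.smul_eq_C_mul, smul_modByMonic, smul_modByMonic, ha3, hb3,
      modByMonic_eq_self_iff hf |>.2 (degree_modByMonic_lt _ hf),
      modByMonic_eq_self_iff hf |>.2 (degree_modByMonic_lt _ hf)] at h3
    rw [← Polynomial.smul_eq_C_mul, ← Polynomial.smul_eq_C_mul]
    exact h3
  have hdu : Polynomial.C u ∣ a3 := by
    rw [Polynomial.C_dvd_iff_dvd_coeff]
    intro i
    have := congrArg (fun p => Polynomial.coeff p i) hz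
    simp at this
    refine huv.dvd_of_dvd_mul_left ⟨b3.coeff i, ?_⟩
    linear_combination this
  obtain ⟨c, hc⟩ := hdu
  have hfin : f ∣ y - c * x1 := by
    have h4 : f ∣ Polynomial.C u * (y - c * x1) := ⟨a1 + (a2 /ₘ f) * x1, by
      linear_combination -ha - x1 * ha2 + x1 * hc⟩
    rw [← modByMonic_eq_zero_iff_dvd hf, ← Polynomial.smul_eq_C_mul, smul_modByMonic] at h4
    rw [← modByMonic_eq_zero_iff_dvd hf]
    exact (smul_eq_zero.1 h4).resolve_left hu
  obtain ⟨z, hz'⟩ := hfin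
  exact Ideal.mem_span_pair.2 ⟨z, c, by linear_combination -hz'⟩

section NN
open Polynomial MvPolynomial Ideal Nat RingHom List
variable {k : Type*} [Field k] {n : ℕ} (f : MvPolynomial (Fin (n + 1)) k)
variable (v w : Fin (n + 1) →₀ ℕ)

noncomputable abbrev NT1 (c : k) :
    MvPolynomial (Fin (n + 1)) k →ₐ[k] MvPolynomial (Fin (n + 1)) k :=
  aeval fun i ↦ if i = 0 then X 0 else X i + c • X 0 ^ ((2 + f.totalDegree) ^ i.1)

lemma nt1_comp_t1_neg (c : k) : (NT1 f c).comp (NT1 f (-c)) = AlgHom.id _ _ := by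
  rw [comp_aeval, ← MvPolynomial.aeval_X_left]
  ext i v
  cases i using Fin.cases <;> simp

noncomputable abbrev NT := AlgEquiv.ofAlgHom (NT1 f 1) (NT1 f (-1))
  (nt1_comp_t1_neg f 1) (by simpa using nt1_comp_t1_neg f (-1))

lemma nsum_r_mul_ne (vlt : ∀ i, v i < (2 + f.totalDegree)) (wlt : ∀ i, w i < (2 + f.totalDegree))
    (ne : v ≠ w) :
    ∑ x : Fin (n + 1), ((2 + f.totalDegree) ^ x.1) * v x ≠
      ∑ x : Fin (n + 1), ((2 + f.totalDegree) ^ x.1) * w x := by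
  intro h
  refine ne <| Finsupp.ext <| congrFun <| ofFn_inj.mp ?_
  apply ofDigits_inj_of_len_eq (Nat.lt_add_right f.totalDegree one_lt_two)
    (by simp) (by grind) (by grind)
  simpa only [ofDigits_eq_sum_mapIdx, mapIdx_eq_ofFn, get_ofFn, length_ofFn,
    Fin.val_cast, mul_comm, sum_ofFn] using! h

lemma ndegreeOf_zero_t {a : k} (ha : a ≠ 0) : ((NT f) (monomial v a)).degreeOf 0 =
    ∑ i : Fin (n + 1), ((2 + f.totalDegree) ^ i.1) * v i := by
  rw [← natDegree_finSuccEquiv, monomial_eq, Finsupp.prod_pow v fun a ↦ X a]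
  simp only [Fin.prod_univ_succ, Fin.sum_univ_succ, map_mul, map_prod, map_pow,
    AlgEquiv.ofAlgHom_apply, MvPolynomial.aeval_C, MvPolynomial.aeval_X, if_pos, Fin.succ_ne_zero,
    ite_false, one_smul, map_add, finSuccEquiv_X_zero, finSuccEquiv_X_succ, algebraMap_eq]
  have h (i : Fin n) :
      (Polynomial.C (X (R := k) i) + Polynomial.X ^ ((2 + f.totalDegree) ^ i.succ.1)) ^ v i.succ
        ≠ 0 :=
    pow_ne_zero (v i.succ) (leadingCoeff_ne_zero.mp <| by simp [add_comm, leadingCoeff_X_pow_add_C])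
  rw [natDegree_mul (by simp [ha]) (mul_ne_zero (by simp) (Finset.prod_ne_zero_iff.mpr
    (fun i _ ↦ h i))), natDegree_mul (by simp) (Finset.prod_ne_zero_iff.mpr (fun i _ ↦ h i)),
    natDegree_prod _ _ (fun i _ ↦ h i), natDegree_finSuccEquiv, degreeOf_C]
  simpa only [natDegree_pow, zero_add, natDegree_X, mul_one, Fin.val_zero, pow_zero, one_mul,
    add_right_inj] using Finset.sum_congr rfl (fun i _ ↦ by
    rw [add_comm (Polynomial.C _), natDegree_X_pow_add_C, mul_comm])

lemma ndegreeOf_t_ne_of_ne (hv : v ∈ f.support) (hw : w ∈ f.support) (ne : v ≠ w) :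
    (NT f <| monomial v <| coeff v f).degreeOf 0 ≠
    (NT f <| monomial w <| coeff w f).degreeOf 0 := by
  rw [ndegreeOf_zero_t _ _ <| mem_support_iff.mp hv, ndegreeOf_zero_t _ _ <| mem_support_iff.mp hw]
  refine nsum_r_mul_ne f v w (fun i ↦ ?_) (fun i ↦ ?_) ne <;>
  exact lt_of_le_of_lt ((monomial_le_degreeOf i ‹_›).trans (degreeOf_le_totalDegree f i))
    (by lia)

lemma nleadingCoeff_finSuccEquiv_t :
    (finSuccEquiv k n ((NT f) ((monomial v) (coeff v f)))).leadingCoeff =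
    algebraMap k _ (coeff v f) := by
  rw [monomial_eq, Finsupp.prod_fintype]
  · simp only [map_mul, map_prod, leadingCoeff_mul, leadingCoeff_prod]
    rw [AlgEquiv.ofAlgHom_apply, algHom_C, algebraMap_eq, finSuccEquiv_apply,
      eval₂Hom_C, coe_comp]
    simp only [AlgEquiv.ofAlgHom_apply, Function.comp_apply, leadingCoeff_C, map_pow,
      leadingCoeff_pow, algebraMap_eq]
    have : ∀ j, ((finSuccEquiv k n) ((NT1 f) 1 (X j))).leadingCoeff = 1 := fun j ↦ by
      by_cases h : j = 0
      · simp [h, finSuccEquiv_apply]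
      · simp only [aeval_eq_bind₁, bind₁_X_right, if_neg h, one_smul, map_add, map_pow]
        obtain ⟨i, rfl⟩ := Fin.exists_succ_eq.mpr h
        simp [finSuccEquiv_X_succ, finSuccEquiv_X_zero, add_comm]
    simp only [this, one_pow, Finset.prod_const_one, mul_one]
  exact fun i ↦ pow_zero _

lemma nT_leadingcoeff_isUnit (fne : f ≠ 0) :
    IsUnit (finSuccEquiv k n (NT f f)).leadingCoeff := by
  obtain ⟨v, vin, vs⟩ := Finset.exists_max_image f.support
    (fun v ↦ (NT f ((monomial v) (coeff v f))).degreeOf 0) (support_nonempty.mpr fne)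
  set h := fun w ↦ (MvPolynomial.monomial w) (coeff w f)
  simp only [← natDegree_finSuccEquiv] at vs
  replace vs : ∀ x ∈ f.support \ {v}, (finSuccEquiv k n ((NT f) (h x))).degree <
      (finSuccEquiv k n ((NT f) (h v))).degree := by
    intro x hx
    obtain ⟨h1, h2⟩ := Finset.mem_sdiff.mp hx
    apply degree_lt_degree <| lt_of_le_of_ne (vs x h1) ?_
    simpa only [natDegree_finSuccEquiv]
      using ndegreeOf_t_ne_of_ne f _ _ h1 vin <| ne_of_not_mem_cons h2
  have coeff : (finSuccEquiv k n ((NT f) (h v + ∑ x ∈ f.support \ {v}, h x))).leadingCoeff =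
      (finSuccEquiv k n ((NT f) (h v))).leadingCoeff := by
    simp only [map_add, map_sum]
    rw [add_comm]
    apply leadingCoeff_add_of_degree_lt <| (lt_of_le_of_lt <| degree_sum_le _ _) ?_
    have h2 : h v ≠ 0 := by simpa [h] using mem_support_iff.mp vin
    replace h2 : (finSuccEquiv k n ((NT f) (h v))) ≠ 0 := fun eq ↦ h2 <|
      by simpa only [map_eq_zero_iff _ (AlgEquiv.injective _)] using eq
    exact (Finset.sup_lt_iff <| Ne.bot_lt (fun x ↦ h2 <| degree_eq_bot.mp x)).mpr vs
  nth_rw 2 [← f.support_sum_monomial_coeff]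
  rw [Finset.sum_eq_add_sum_sdiff_singleton_of_mem vin h]
  rw [nleadingCoeff_finSuccEquiv_t] at coeff
  simpa only [coeff, algebraMap_eq] using (mem_support_iff.mp vin).isUnit.map MvPolynomial.C

lemma exists_monic_change (fne : f ≠ 0) :
    ∃ T : MvPolynomial (Fin (n + 1)) k ≃+* (MvPolynomial (Fin n) k)[X],
      ∃ c : (MvPolynomial (Fin n) k), IsUnit c ∧ (Polynomial.C c * T f).Monic := by
  obtain ⟨u, hu⟩ := nT_leadingcoeff_isUnit f fne
  refine ⟨((NT f).trans (finSuccEquiv k n)).toRingEquiv, ↑u⁻¹, Units.isUnit _, ?_⟩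
  have := (monic_of_isUnit_leadingCoeff_inv_smul (nT_leadingcoeff_isUnit f fne))
  rw [Monic, leadingCoeff_mul, leadingCoeff_C]
  change _ * (finSuccEquiv k n (NT f f)).leadingCoeff = 1
  rw [← hu]; simp
end NN


open Polynomial in
lemma dim_comap_le {B : Type*} [CommRing B] (J : Ideal B[X]) (f : B[X]) (hf : f.Monic)
    (hfJ : f ∈ J) : ringKrullDim (B ⧸ J.comap Polynomial.C) ≤ ringKrullDim (B[X] ⧸ J) := by
  refine dim_ge_of_integral (Ideal.quotientMap J Polynomial.C le_rfl) ?_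
    (Ideal.quotientMap_injective)
  have h := hf.quotient_isIntegral hfJ
  have h2 : ((Ideal.quotientMap J Polynomial.C le_rfl).comp
      (Ideal.Quotient.mk (J.comap Polynomial.C))).IsIntegral := by
    intro b
    obtain ⟨p, hp, hp'⟩ := h b
    exact ⟨p, hp, hp'⟩
  exact RingHom.IsIntegral.tower_top _ _ h2

lemma quot_equiv_dim {A B : Type*} [CommRing A] [CommRing B] (T : A ≃+* B) (I : Ideal A) :
    ringKrullDim (B ⧸ I.map (T : A →+* B)) = ringKrullDim (A ⧸ I) :=
  (ringKrullDim_eq_of_ringEquiv (Ideal.quotientEquiv I (I.map (T : A →+* B)) T rfl)).symm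

lemma dim_ge_of_le_irred {n : ℕ} (I : Ideal (MvPolynomial (Fin (n + 1)) ℂ))
    (p : MvPolynomial (Fin (n + 1)) ℂ) (hp : Irreducible p) (hI : I ≤ Ideal.span {p}) :
    (n : WithBot ℕ∞) ≤ ringKrullDim (MvPolynomial (Fin (n + 1)) ℂ ⧸ I) := by
  have h1 : ringKrullDim (MvPolynomial (Fin (n + 1)) ℂ ⧸ Ideal.span {p}) ≤
      ringKrullDim (MvPolynomial (Fin (n + 1)) ℂ ⧸ I) :=
    ringKrullDim_le_of_surjective (Ideal.Quotient.factor hI) (Ideal.Quotient.factor_surjective hI)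
  refine le_trans ?_ h1
  obtain ⟨T, c, hc, hm⟩ := exists_monic_change p hp.ne_zero
  rw [← quot_equiv_dim T, Ideal.map_span, Set.image_singleton]
  refine le_trans ?_ (dim_comap_le _ _ hm
    (Ideal.mul_mem_left _ _ (Ideal.subset_span (Set.mem_singleton _))))
  have hbot : (Ideal.span {(T : MvPolynomial (Fin (n + 1)) ℂ →+*
      Polynomial (MvPolynomial (Fin n) ℂ)) p}).comap Polynomial.C = ⊥ := by
    rw [eq_bot_iff]
    intro b hb
    rw [Ideal.mem_comap, Ideal.mem_span_singleton] at hb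
    by_contra hb0
    have hb0' : b ≠ 0 := hb0
    have hdeg := Polynomial.natDegree_le_of_dvd hb (by simpa using hb0')
    have hd : (T p).natDegree = 0 := by simpa using hdeg
    rw [Polynomial.eq_C_of_natDegree_eq_zero hd, ← map_mul] at hm
    have h3 : c * (T p).coeff 0 = 1 := by simpa [Polynomial.Monic] using hm
    have h4 : IsUnit (T p) := by
      rw [Polynomial.eq_C_of_natDegree_eq_zero hd]
      exact IsUnit.of_mul_eq_one (Polynomial.C c) (by rw [mul_comm, ← map_mul, h3, map_one])
    exact hp.not_isUnit ((MulEquiv.isUnit_map T).1 h4)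
  rw [hbot, ringKrullDim_eq_of_ringEquiv (RingEquiv.quotientBot _)]
  simp

lemma exists_coprime_pair {R : Type*} [CommRing R] [IsDomain R] [UniqueFactorizationMonoid R]
    (J : Ideal R) (hJ0 : J ≠ ⊥) (hJ : ∀ p, Irreducible p → ¬ J ≤ Ideal.span {p}) :
    ∃ u ∈ J, ∃ v ∈ J, u ≠ 0 ∧ IsRelPrime u v := by
  classical
  obtain ⟨u, hu, hu0⟩ := Submodule.exists_mem_ne_zero_of_ne_bot hJ0
  have key : ¬ ((J : Set R) ⊆ ⋃ i ∈ (↑(UniqueFactorizationMonoid.factors u).toFinset : Set R),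
      (Ideal.span {i} : Ideal R)) := by
    rw [Ideal.subset_union_prime 0 0]
    · rintro ⟨i, hi, hi'⟩
      exact hJ i (UniqueFactorizationMonoid.irreducible_of_factor i (by simpa using hi)) hi'
    · intro i hi _ _
      have hpi := UniqueFactorizationMonoid.prime_of_factor i (by simpa using hi)
      exact (Ideal.span_singleton_prime hpi.ne_zero).2 hpi
  rw [Set.not_subset] at key
  obtain ⟨v, hv, hv'⟩ := key
  refine ⟨u, hu, v, hv, hu0, ?_⟩
  refine WfDvdMonoid.isRelPrime_of_no_irreducible_factors (by simp [hu0]) ?_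
  intro z hz hzu hzv
  obtain ⟨i, hi, hzi⟩ := UniqueFactorizationMonoid.exists_mem_factors_of_dvd hu0 hz hzu
  apply hv'
  simp only [Set.mem_iUnion]
  exact ⟨i, by simpa using hi, Ideal.mem_span_singleton.2 (hzi.symm.dvd.trans hzv)⟩

lemma colon_main {n : ℕ} (I : Ideal (MvPolynomial (Fin (n + 2)) ℂ))
    (hI : ¬ (n : WithBot ℕ∞) ≤ ringKrullDim (MvPolynomial (Fin (n + 2)) ℂ ⧸ I))
    (f x1 y : MvPolynomial (Fin (n + 2)) ℂ) (hf0 : f ≠ 0) (hfI : f ∈ I) (hcop : IsRelPrime f x1)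
    (hy : ∀ z ∈ I, z * y ∈ Ideal.span {f, x1}) : y ∈ Ideal.span {f, x1} := by
  obtain ⟨T, c, hc, hm⟩ := exists_monic_change f hf0
  have hcC : IsUnit (Polynomial.C c) := hc.map Polynomial.C
  have hfT : T f ∈ I.map (T : _ →+* Polynomial (MvPolynomial (Fin (n + 1)) ℂ)) :=
    Ideal.mem_map_of_mem _ hfI
  set J := (I.map (T : _ →+* Polynomial (MvPolynomial (Fin (n + 1)) ℂ))).comap Polynomial.C with hJ
  have hdim := dim_comap_le _ _ hm (Ideal.mul_mem_left _ (Polynomial.C c) hfT)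
  rw [quot_equiv_dim T, ← hJ] at hdim
  have hJp : ∀ p, Irreducible p → ¬ J ≤ Ideal.span {p} := fun p hp hle =>
    hI ((dim_ge_of_le_irred J p hp hle).trans hdim)
  have hJ0 : J ≠ ⊥ := by
    intro h
    exact hJp (MvPolynomial.X 0) (MvPolynomial.X_prime.irreducible) (by rw [h]; exact bot_le)
  obtain ⟨u, hu, v, hv, hu0, huv⟩ := exists_coprime_pair J hJ0 hJp
  have hspan : Ideal.span {Polynomial.C c * T f, T x1} =
      (Ideal.span {f, x1}).map (T : _ →+* Polynomial (MvPolynomial (Fin (n + 1)) ℂ)) := by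
    rw [Ideal.map_span, Set.image_pair, Ideal.span_insert, Ideal.span_insert,
      Ideal.span_singleton_mul_left_unit hcC]
    rfl
  have hmem : ∀ w ∈ J, Polynomial.C w * T y ∈ Ideal.span {Polynomial.C c * T f, T x1} := by
    intro w hw
    rw [hspan]
    have hw' : Polynomial.C w ∈ I.map (T : _ →+* Polynomial (MvPolynomial (Fin (n + 1)) ℂ)) := hw
    obtain ⟨z, hz, hzw⟩ := (Ideal.mem_map_iff_of_surjective _ T.surjective).1 hw'
    rw [← hzw]
    have := Ideal.mem_map_of_mem (T : _ →+* Polynomial (MvPolynomial (Fin (n + 1)) ℂ)) (hy z hz)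
    simpa using this
  have hcop' : IsRelPrime (Polynomial.C c * T f) (T x1) := by
    rw [isRelPrime_mul_unit_left_left hcC]
    intro d h1 h2
    have e1 : T.symm d ∣ f := by simpa using map_dvd T.symm h1
    have e2 : T.symm d ∣ x1 := by simpa using map_dvd T.symm h2
    exact (MulEquiv.isUnit_map T.symm).1 (hcop e1 e2)
  have := colon_aux _ _ _ hm hcop' u v hu0 huv (hmem u hu) (hmem v hv)
  rw [hspan] at this
  obtain ⟨z, hz, hzw⟩ := (Ideal.mem_map_iff_of_surjective _ T.surjective).1 this
  rwa [← T.injective hzw]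

lemma chain_rule {N : ℕ} (F : Fin N → MvPolynomial (Fin N) ℂ) (h : MvPolynomial (Fin N) ℂ)
    (i : Fin N) : pderiv i (aeval F h) = ∑ l, aeval F (pderiv l h) * pderiv i (F l) := by
  induction h using MvPolynomial.induction_on with
  | C a => simp [← algebraMap_eq]
  | add p q hp hq => simp only [map_add, hp, hq, add_mul, Finset.sum_add_distrib]
  | mul_X p j hp =>
    simp only [map_mul, aeval_X, Derivation.leibniz, hp, smul_eq_mul, map_add, pderiv_X, add_mul,
      Finset.sum_add_distrib, Finset.mul_sum]
    congr 1
    · rw [Finset.sum_eq_single j]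
      · simp
      · intro b _ hb
        simp [hb]
      · simp
    · exact Finset.sum_congr rfl fun l _ => by ring

lemma endo_pow_le {N : ℕ} (F : Fin N → MvPolynomial (Fin N) ℂ)
    (hF : ∀ x : Fin N → ℂ, (∀ i, eval x (F i) = 0) → x = 0) :
    ∃ m, ∀ s : Fin N →₀ ℕ, m ≤ s.degree →
      monomial s (1 : ℂ) ∈ Ideal.span (Set.range F) := by
  set I := Ideal.span (Set.range F) with hI
  have hX : ∀ i, (X i : MvPolynomial (Fin N) ℂ) ∈ I.radical := by
    intro i
    rw [← MvPolynomial.vanishingIdeal_zeroLocus_eq_radical (K := ℂ), mem_vanishingIdeal_iff]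
    intro x hx
    have : x = 0 := by
      apply hF
      intro j
      have := hx (F j) (Ideal.subset_span ⟨j, rfl⟩)
      rwa [aeval_eq_eval] at this
    simp [this]
  obtain ⟨m, hm⟩ := Ideal.exists_radical_pow_le_of_fg I (IsNoetherian.noetherian _)
  refine ⟨m, fun s hs => hm (Ideal.pow_le_pow_right hs ?_)⟩
  rw [monomial_eq, Finsupp.prod_fintype _ _ (by simp), C_1, one_mul, Finsupp.degree_eq_sum,
    ← Finset.prod_pow_eq_pow_sum]
  exact Ideal.prod_mem_prod fun i _ => Ideal.pow_mem_pow (hX i) _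

lemma endo_finite {N q : ℕ} (hq : 1 ≤ q) (F : Fin N → MvPolynomial (Fin N) ℂ)
    (hhom : ∀ i, (F i).IsHomogeneous q)
    (hF : ∀ x : Fin N → ℂ, (∀ i, eval x (F i) = 0) → x = 0) :
    Algebra.IsIntegral (aeval F : MvPolynomial (Fin N) ℂ →ₐ[ℂ] MvPolynomial (Fin N) ℂ).range
      (MvPolynomial (Fin N) ℂ) := by
  obtain ⟨m, hm⟩ := endo_pow_le F hF
  set B := (aeval F : MvPolynomial (Fin N) ℂ →ₐ[ℂ] MvPolynomial (Fin N) ℂ).range with hB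
  set G : Set (MvPolynomial (Fin N) ℂ) := (fun s => monomial s (1 : ℂ)) '' {s | s.degree ≤ m + q} with hG
  have hGf : G.Finite := (Finsupp.finite_of_degree_le (m + q)).image _
  set W := Submodule.span B G with hW
  have hFB : ∀ l, F l ∈ B := fun l => ⟨X l, by simp⟩
  have hCB : ∀ c, C c ∈ B := fun c => B.algebraMap_mem c
  have key : ∀ k, ∀ s : Fin N →₀ ℕ, s.degree = k → monomial s (1 : ℂ) ∈ W := by
    intro k
    induction k using Nat.strong_induction_on with
    | _ k ih =>
    intro s hs
    by_cases hk : s.degree ≤ m + q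
    · exact Submodule.subset_span ⟨s, hk, rfl⟩
    · obtain ⟨a, ha⟩ := (Ideal.mem_span_range_iff_exists_fun).1 (hm s (by omega))
      have h1 : monomial s (1 : ℂ) = ∑ l, homogeneousComponent (k - q) (a l) * F l := by
        have : monomial s (1 : ℂ) = homogeneousComponent (k - q + q) (monomial s (1 : ℂ)) := by
          rw [homogeneousComponent_eq_self]
          apply isHomogeneous_monomial
          omega
        rw [this, ← ha, map_sum]
        exact Finset.sum_congr rfl fun l _ => hc_mul _ _ (hhom l)
      rw [h1]
      refine Submodule.sum_mem _ fun l _ => ?_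
      rw [mul_comm]
      refine W.smul_mem (⟨F l, hFB l⟩ : B) ?_
      rw [MvPolynomial.as_sum (homogeneousComponent (k - q) (a l))]
      refine Submodule.sum_mem _ fun t ht => ?_
      have ht' : t.degree = k - q := by
        have := (homogeneousComponent_isHomogeneous (k - q) (a l)) (mem_support_iff.1 ht)
        rw [Finsupp.degree_eq_weight_one]; exact this
      rw [← mul_one (coeff t _), ← C_mul_monomial]
      exact W.smul_mem (⟨C _, hCB _⟩ : B) (ih (k - q) (by omega) t ht')
  have htop : W = ⊤ := by
    rw [eq_top_iff]
    intro p _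
    rw [MvPolynomial.as_sum p]
    refine Submodule.sum_mem _ fun t ht => ?_
    rw [← mul_one (coeff t _), ← C_mul_monomial]
    exact W.smul_mem (⟨C _, hCB _⟩ : B) (key _ t rfl)
  have : Module.Finite B (MvPolynomial (Fin N) ℂ) :=
    ⟨Submodule.fg_def.2 ⟨G, hGf, htop⟩⟩
  infer_instance

lemma endo_integral {N q : ℕ} (hq : 1 ≤ q) (F : Fin N → MvPolynomial (Fin N) ℂ)
    (hhom : ∀ i, (F i).IsHomogeneous q)
    (hF : ∀ x : Fin N → ℂ, (∀ i, eval x (F i) = 0) → x = 0) :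
    (aeval F : MvPolynomial (Fin N) ℂ →ₐ[ℂ] MvPolynomial (Fin N) ℂ).toRingHom.IsIntegral := by
  have h := endo_finite hq F hhom hF
  set φ := (aeval F : MvPolynomial (Fin N) ℂ →ₐ[ℂ] MvPolynomial (Fin N) ℂ)
  have h2 : (φ.rangeRestrict.toRingHom).IsIntegral :=
    RingHom.isIntegral_of_surjective _ φ.rangeRestrict_surjective
  exact RingHom.IsIntegral.trans _ (algebraMap φ.range _) h2 h.1

lemma der_zero {S : Type*} [CommRing S] [IsDomain S] [Algebra ℂ S] (B : Subalgebra ℂ S)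
    (D : Derivation ℂ S S) (hD : ∀ b ∈ B, D b = 0) (x : S) :
    ∀ k, ∀ P : Polynomial B, P ≠ 0 → P.natDegree = k → Polynomial.aeval x P = 0 → D x = 0 := by
  have hder : ∀ P : Polynomial B, D (Polynomial.aeval x P) =
      Polynomial.aeval x (Polynomial.derivative P) * D x := by
    intro P
    induction P using Polynomial.induction_on' with
    | add p q hp hq => simp only [map_add, hp, hq, add_mul]
    | monomial n b =>
      rw [Polynomial.aeval_monomial, Polynomial.derivative_monomial, Polynomial.aeval_monomial,
        Derivation.leibniz, Derivation.leibniz_pow]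
      have : D (algebraMap B S b) = 0 := hD _ b.2
      rw [this]
      simp
      ring
  have hcz : CharZero B := charZero_of_injective_algebraMap (algebraMap ℂ B).injective
  intro k
  induction k with
  | zero =>
    intro P hP hk h0
    rw [Polynomial.eq_C_of_natDegree_eq_zero hk] at h0 hP
    simp at h0 hP
    exact absurd h0 hP
  | succ k ih =>
    intro P hP hk h0
    have h1 := hder P
    rw [h0, map_zero] at h1
    rcases mul_eq_zero.1 h1.symm with h2 | h2
    · have hd : (Polynomial.derivative P).natDegree = k := by
        rw [Polynomial.natDegree_derivative, hk]; rfl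
      refine ih _ ?_ hd h2
      intro h3
      have := Polynomial.derivative_eq_zero.1 h3
      omega
    · exact h2

lemma det_ne_zero {N q : ℕ} (hq : 1 ≤ q) (F : Fin N → MvPolynomial (Fin N) ℂ)
    (hhom : ∀ i, (F i).IsHomogeneous q)
    (hF : ∀ x : Fin N → ℂ, (∀ i, eval x (F i) = 0) → x = 0) :
    (Matrix.of fun l i => pderiv i (F l)).det ≠ 0 := by
  intro hdet
  obtain ⟨θ, hθ, hθ'⟩ := Matrix.exists_mulVec_eq_zero_iff.2 hdet
  set D : Derivation ℂ (MvPolynomial (Fin N) ℂ) (MvPolynomial (Fin N) ℂ) :=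
    ∑ i, θ i • pderiv i with hDdef
  have hDp : ∀ p, D p = ∑ i, pderiv i p * θ i := by
    intro p
    have h1 := congrFun (map_sum (Derivation.coeFnAddMonoidHom (R := ℂ)
      (A := MvPolynomial (Fin N) ℂ) (M := MvPolynomial (Fin N) ℂ))
      (fun i => θ i • pderiv i) Finset.univ) p
    rw [Finset.sum_apply] at h1
    refine h1.trans ?_
    exact Finset.sum_congr rfl fun i _ => by simp [mul_comm]
  have hint := endo_finite hq F hhom hF
  set B := (aeval F : MvPolynomial (Fin N) ℂ →ₐ[ℂ] MvPolynomial (Fin N) ℂ).range with hB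
  have hDF : ∀ l, D (F l) = 0 := by
    intro l
    have := congrFun hθ' l
    rw [hDp]
    simpa [Matrix.mulVec, dotProduct] using this
  have hDB : ∀ b ∈ B, D b = 0 := by
    rintro b ⟨p, rfl⟩
    change D (aeval F p) = 0
    rw [hDp]
    simp only [chain_rule, Finset.sum_mul]
    rw [Finset.sum_comm]
    refine Finset.sum_eq_zero fun l _ => ?_
    simp only [mul_assoc, ← Finset.mul_sum]
    rw [← hDp, hDF, mul_zero]
  apply hθ
  funext i
  obtain ⟨P, hP, hP'⟩ := hint.1 (X i)
  have := der_zero B D hDB (X i) _ P hP.ne_zero rfl hP'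
  rw [hDp] at this
  simpa [pderiv_X, Pi.single_apply] using this

lemma generic_vec {N : ℕ} (x : Fin N → MvPolynomial (Fin N) ℂ) (j j' : Fin N) (hjj : j' ≠ j)
    (hx : ∀ p, Irreducible p → ∃ l, ¬ p ∣ x l) (hxj : x j ≠ 0) :
    ∃ v : Fin N → ℂ, (∃ k, k ≠ j ∧ v k ≠ 0) ∧ (∑ l, x l * C (v l)) ≠ 0 ∧
      IsRelPrime (x j) (∑ l, x l * C (v l)) := by
  classical
  let L : (Fin N → ℂ) →ₗ[ℂ] MvPolynomial (Fin N) ℂ :=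
    { toFun := fun v => ∑ l, x l * C (v l)
      map_add' := fun v w => by simp [mul_add, Finset.sum_add_distrib]
      map_smul' := fun c v => by
        simp only [Pi.smul_apply, smul_eq_mul, C_mul, RingHom.id_apply, smul_eq_C_mul,
          Finset.mul_sum]
        exact Finset.sum_congr rfl fun l _ => by ring }
  have hL : ∀ v, L v = ∑ l, x l * C (v l) := fun _ => rfl
  let V : MvPolynomial (Fin N) ℂ → Submodule ℂ (Fin N → ℂ) := fun p =>
    ((Ideal.span {p}).restrictScalars ℂ).comap L
  have hV : ∀ p v, v ∈ V p ↔ p ∣ L v := fun p v => by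
    simp [V, Ideal.mem_span_singleton]
  let V0 : Submodule ℂ (Fin N → ℂ) := Submodule.span ℂ {Pi.single j 1}
  let s : Finset (Submodule ℂ (Fin N → ℂ)) :=
    insert V0 (insert (V 0) ((UniqueFactorizationMonoid.factors (x j)).toFinset.image V))
  have hsingle : ∀ l, L (Pi.single l 1) = x l := by
    intro l
    rw [hL, Finset.sum_eq_single l]
    · simp
    · intro b _ hb
      simp [hb]
    · simp
  have hs : ⊤ ∉ s := by
    intro hmem
    simp only [s, Finset.mem_insert, Finset.mem_image] at hmem
    rcases hmem with h | h | ⟨p, hp, h⟩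
    · have : Pi.single j' (1 : ℂ) ∈ V0 := h ▸ Submodule.mem_top
      obtain ⟨c, hc⟩ := Submodule.mem_span_singleton.1 this
      have := congrFun hc j'
      simp [hjj] at this
    · have : Pi.single j (1 : ℂ) ∈ V 0 := h ▸ Submodule.mem_top
      rw [hV, hsingle, zero_dvd_iff] at this
      exact hxj this
    · obtain ⟨l, hl⟩ := hx p (UniqueFactorizationMonoid.irreducible_of_factor p (by simpa using hp))
      have : Pi.single l (1 : ℂ) ∈ V p := h ▸ Submodule.mem_top
      rw [hV, hsingle] at this
      exact hl this
  have hne := Subspace.biUnion_ne_univ_of_top_notMem hs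
  rw [Set.ne_univ_iff_exists_notMem] at hne
  obtain ⟨v, hv⟩ := hne
  have hv' : ∀ W ∈ s, v ∉ W := by
    intro W hW hvW
    apply hv
    simp only [Set.mem_iUnion]
    exact ⟨W, hW, hvW⟩
  refine ⟨v, ?_, ?_, ?_⟩
  · by_contra hcon
    push Not at hcon
    apply hv' V0 (by simp [s])
    refine Submodule.mem_span_singleton.2 ⟨v j, ?_⟩
    funext k
    by_cases hk : k = j
    · subst hk; simp
    · simp [hk, hcon k hk]
  · intro h0
    apply hv' (V 0) (by simp [s])
    rw [hV, hL, h0]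
  · refine WfDvdMonoid.isRelPrime_of_no_irreducible_factors (by simp [hxj]) ?_
    intro z hz hzu hzv
    obtain ⟨i, hi, hzi⟩ := UniqueFactorizationMonoid.exists_mem_factors_of_dvd hxj hz hzu
    apply hv' (V i) ?_
    · rw [hV, hL]; exact hzi.symm.dvd.trans hzv
    · simp only [s, Finset.mem_insert, Finset.mem_image]
      exact Or.inr (Or.inr ⟨i, by simpa using hi, rfl⟩)

lemma det_zero_of_dim {n : ℕ} (s r p e : ℕ) (x : Fin (n + 2) → MvPolynomial (Fin (n + 2)) ℂ)
    (M : Matrix (Fin (n + 2)) (Fin (n + 2)) (MvPolynomial (Fin (n + 2)) ℂ))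
    (η : Fin (n + 2) → MvPolynomial (Fin (n + 2)) ℂ)
    (g : MvPolynomial (Fin (n + 2)) ℂ)
    (hx : ∀ l, (x l).IsHomogeneous p) (hM : ∀ l i, (M l i).IsHomogeneous s)
    (hη : ∀ i, (η i).IsHomogeneous r) (hrel : ∀ i, ∑ l, x l * M l i = g * η i)
    (hdim : ¬ (n : WithBot ℕ∞) ≤
      ringKrullDim (MvPolynomial (Fin (n + 2)) ℂ ⧸ Ideal.span (Set.range x)))
    (he : n * s + r = e + p) (h1 : e + s < p) (h2 : e + r < p) : M.det = 0 := by
  classical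
  have hirr : ∀ p, Irreducible p → ∃ l, ¬ p ∣ x l := by
    intro p hp
    by_contra hcon
    push Not at hcon
    apply hdim
    refine le_trans ?_ (dim_ge_of_le_irred (n := n + 1) _ p hp ?_)
    · exact_mod_cast Nat.le_succ n
    · rw [Ideal.span_le]
      rintro _ ⟨l, rfl⟩
      exact Ideal.mem_span_singleton.2 (hcon l)
  obtain ⟨j, hj⟩ : ∃ j, x j ≠ 0 := by
    obtain ⟨l, hl⟩ := hirr (X 0) X_prime.irreducible
    exact ⟨l, fun h => hl (h ▸ dvd_zero _)⟩
  obtain ⟨j', hj'⟩ := exists_ne j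
  obtain ⟨v, ⟨k, hkj, hvk⟩, hne, hcop⟩ := generic_vec x j j' hj' hirr hj
  set Q : Matrix (Fin (n + 2)) (Fin (n + 2)) ℂ := (1 : Matrix _ _ ℂ).updateCol k v with hQ
  have hQdet : Q.det = v k := by
    rw [hQ, ← Matrix.cramer_apply, Matrix.cramer_one]; rfl
  have hQu : IsUnit Q.det := by rw [hQdet]; exact hvk.isUnit
  set Qc : Matrix (Fin (n + 2)) (Fin (n + 2)) (MvPolynomial (Fin (n + 2)) ℂ) := Q.map C with hQc
  set Qi : Matrix (Fin (n + 2)) (Fin (n + 2)) (MvPolynomial (Fin (n + 2)) ℂ) := Q⁻¹.map C with hQi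
  have hQQ : Qc * Qi = 1 := by
    rw [hQc, hQi, ← Matrix.map_mul, Matrix.mul_nonsing_inv _ hQu, Matrix.map_one] <;> simp
  set x' := Matrix.vecMul x Qc with hx'
  have hxx : Matrix.vecMul x' Qi = x := by
    rw [hx', Matrix.vecMul_vecMul, hQQ, Matrix.vecMul_one]
  have hx'j : x' j = x j := by
    simp only [hx', Matrix.vecMul, dotProduct, hQc, hQ, Matrix.map_apply]
    rw [Finset.sum_eq_single j]
    · simp [Matrix.updateCol_ne hkj.symm]
    · intro b _ hb
      simp [Matrix.updateCol_ne hkj.symm, hb]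
    · simp
  have hx'k : x' k = ∑ l, x l * C (v l) := by
    simp [hx', Matrix.vecMul, dotProduct, hQc, hQ]
  have hdet : (Qi * M).det = 0 := by
    refine core s r p e x' (Qi * M) η g ?_ ?_ hη ?_ j k hkj.symm ?_ ?_ (by simpa using he) h1 h2
      ?_ ?_
    · intro l
      simp only [hx', Matrix.vecMul, dotProduct]
      refine IsHomogeneous.sum _ _ _ fun i _ => ?_
      simpa [hQc] using (hx i).mul (isHomogeneous_C (Fin (n + 2)) (Q i l))
    · intro l i
      rw [Matrix.mul_apply]
      refine IsHomogeneous.sum _ _ _ fun t _ => ?_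
      simpa [hQi] using (isHomogeneous_C (Fin (n + 2)) (Q⁻¹ l t)).mul (hM t i)
    · intro i
      rw [← hrel i]
      have : Matrix.vecMul x' (Qi * M) = Matrix.vecMul x M := by
        rw [← Matrix.vecMul_vecMul, hxx]
      exact congrFun this i
    · rw [hx'j, hx'k]; exact hcop
    · intro y hy
      rw [hx'j, hx'k] at hy ⊢
      refine colon_main _ hdim _ _ y hj (Ideal.subset_span ⟨j, rfl⟩) hcop ?_
      intro z hz
      induction hz using Submodule.span_induction with
      | mem z hz =>
        obtain ⟨l, rfl⟩ := hz
        have : x l = ∑ i, x' i * Qi i l := (congrFun hxx l).symm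
        rw [this, Finset.sum_mul]
        refine Ideal.sum_mem _ fun i _ => ?_
        rw [mul_right_comm]
        exact Ideal.mul_mem_right _ _ (hy i)
      | zero => simp
      | add a b _ _ ha hb => rw [add_mul]; exact Ideal.add_mem _ ha hb
      | smul a b _ hb => rw [smul_eq_mul, mul_assoc]; exact Ideal.mul_mem_left _ _ hb
    · rw [hx'j]; exact hj
    · rw [hx'k]; exact hne
  have : M = Qc * (Qi * M) := by rw [← mul_assoc, hQQ, one_mul]
  rw [this, Matrix.det_mul, hdet, mul_zero]

/-- A totally invariant irreducible hypersurface of `ℙⁿ` (`n ≥ 9`) of degree `n - 2` is not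
normal: its singular locus has dimension `n - 2`, i.e. the Jacobian ring has Krull
dimension `≥ n - 1`. -/
theorem degree_n_sub_two_not_normal (n : ℕ) (hn : 9 ≤ n)
    (h : MvPolynomial (Fin (n + 1)) ℂ) (hirr : Irreducible h)
    (hhom : h.IsHomogeneous (n - 2)) (hinv : IsTotallyInvariant (n + 1) h) :
    ((n - 1 : ℕ) : WithBot ℕ∞) ≤
      ringKrullDim (MvPolynomial (Fin (n + 1)) ℂ ⧸ jacobianIdeal (n + 1) h) := by
  classical
  obtain ⟨q, hq, F, ⟨hFhom, hF0⟩, lam, hlam, hrel⟩ := hinv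
  obtain ⟨m, rfl⟩ : ∃ m, n = m + 1 := ⟨n - 1, by omega⟩
  by_contra hdim
  rw [Nat.add_sub_cancel] at hdim
  have hint := endo_integral (by omega : 1 ≤ q) F hFhom hF0
  set φ := (aeval F : MvPolynomial (Fin (m + 1 + 1)) ℂ →ₐ[ℂ] MvPolynomial (Fin (m + 1 + 1)) ℂ)
    with hφ
  set x : Fin (m + 2) → MvPolynomial (Fin (m + 2)) ℂ := fun l => φ (pderiv l h) with hx
  have hpd : ∀ l, (pderiv l h).IsHomogeneous (m - 2) := by
    intro l
    have := hhom.pderiv (i := l)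
    rwa [show m + 1 - 2 - 1 = m - 2 by omega] at this
  have hle : jacobianIdeal (m + 1 + 1) h ≤ (Ideal.span (Set.range x)).comap φ.toRingHom := by
    rw [jacobianIdeal, Ideal.span_le]
    have hp : ∀ l, pderiv l h ∈ (Ideal.span (Set.range x)).comap φ.toRingHom := fun l =>
      Ideal.subset_span ⟨l, rfl⟩
    intro y hy
    rcases hy with rfl | ⟨l, rfl⟩
    · have heu := hhom.sum_X_mul_pderiv
      have hc : ((m + 1 - 2 : ℕ) : ℂ) ≠ 0 := by
        rw [Nat.cast_ne_zero]; omega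
      have hy2 : y = C (((m + 1 - 2 : ℕ) : ℂ)⁻¹) * ∑ i, X i * pderiv i y := by
        rw [heu, nsmul_eq_mul, ← mul_assoc]
        have : ((m + 1 - 2 : ℕ) : MvPolynomial (Fin (m + 1 + 1)) ℂ) = C ((m + 1 - 2 : ℕ) : ℂ) := by
          simp
        rw [this, ← C_mul, inv_mul_cancel₀ hc, C_1, one_mul]
      rw [hy2]
      exact Ideal.mul_mem_left _ _ (Ideal.sum_mem _ fun i _ => Ideal.mul_mem_left _ _ (hp i))
    · exact hp l
  have hdim2 : ¬ (m : WithBot ℕ∞) ≤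
      ringKrullDim (MvPolynomial (Fin (m + 2)) ℂ ⧸ Ideal.span (Set.range x)) := by
    intro hcon
    apply hdim
    refine hcon.trans (dim_le_of_integral
      (Ideal.quotientMap (Ideal.span (Set.range x)) φ.toRingHom hle) ?_)
    have h2 : ((Ideal.quotientMap (Ideal.span (Set.range x)) φ.toRingHom hle).comp
        (Ideal.Quotient.mk (jacobianIdeal (m + 1 + 1) h))).IsIntegral := by
      rw [Ideal.quotientMap_comp_mk]
      exact RingHom.IsIntegral.trans _ _ hint
        (RingHom.isIntegral_of_surjective _ Ideal.Quotient.mk_surjective)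
    exact RingHom.IsIntegral.tower_top _ _ h2
  refine det_ne_zero (by omega : 1 ≤ q) F hFhom hF0 ?_
  have hmq : (m - 2) * q = (m - 2) * (q - 1) + (m - 2) := by
    obtain ⟨t, rfl⟩ : ∃ t, q = t + 1 := ⟨q - 1, by omega⟩
    rw [Nat.add_sub_cancel]; ring
  have hbig : 6 * (q - 1) ≤ (m - 2) * (q - 1) := Nat.mul_le_mul_right _ (by omega)
  refine det_zero_of_dim (q - 1) (m - 2) ((m - 2) * q) (2 * (q - 1)) x _ (fun i => pderiv i h)
    (C lam * (q : MvPolynomial (Fin (m + 2)) ℂ) * h ^ (q - 1)) ?_ ?_ hpd ?_ hdim2 ?_ ?_ ?_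
  · intro l
    rw [mul_comm]
    exact (hpd l).aeval F hFhom
  · intro l i
    exact (hFhom l).pderiv
  · intro i
    have h1 := chain_rule F h i
    have h2 := congrArg (pderiv i) hrel
    rw [show aeval F h = φ h from rfl] at h1
    simp only [Matrix.of_apply]
    refine h1.symm.trans (h2.trans ?_)
    rw [pderiv_C_mul, Derivation.leibniz_pow]
    simp [smul_eq_C_mul]
    ring
  · rw [hmq]
    obtain ⟨t, rfl⟩ : ∃ t, m = t + 2 := ⟨m - 2, by omega⟩
    rw [Nat.add_sub_cancel]; ring
  · omega
  · omega
end
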